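/- arXiv:1210.3626 — 6 statements merged into one kernel-verified Lean document; each statement's English description precedes it below -/
import Mathlib

section
/- For every M > 0 there exist M' > M and C > 0 such that for all t > 0 and all z ∈ ℝ: ∫_{-∞}^{∞} t^{−1/2} exp(−(z−y)²/(Mt)) (1+|y|)^{−3/2} dy ≤ C [ (1+|z|+√t)^{−3/2} + (1+t)^{−1/2} exp(−z²/(M't)) ]. -/
open MeasureTheory Real

theorem rpow_neg_three_halves_le_four_mul {a b : ℝ} (ha : 0 < a) (hab : a ≤ 2 * b) :
    b ^ (-(3/2 : ℝ)) ≤ 4 * a ^ (-(3/2 : ℝ)) := by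
  have hb : 0 < b := by linarith
  have h : (2 : ℝ) ^ (-(2 : ℝ)) ≤ 2 ^ (-(3/2 : ℝ)) :=
    rpow_le_rpow_of_exponent_le one_le_two (by norm_num)
  have h4 : (2 : ℝ) ^ (-(2 : ℝ)) = 1 / 4 := by
    rw [rpow_neg zero_le_two, rpow_two]; norm_num
  calc b ^ (-(3/2 : ℝ)) ≤ 4 * (2 ^ (-(3/2 : ℝ)) * b ^ (-(3/2 : ℝ))) := by
        nlinarith [rpow_pos_of_pos hb (-(3/2 : ℝ))]
    _ = 4 * (2 * b) ^ (-(3/2 : ℝ)) := by rw [mul_rpow zero_le_two hb.le]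
    _ ≤ 4 * a ^ (-(3/2 : ℝ)) :=
        mul_le_mul_of_nonneg_left (rpow_le_rpow_of_nonpos ha hab (by norm_num)) zero_le_four

theorem integrable_one_add_abs_rpow_neg_three_halves :
    Integrable fun y : ℝ => (1 + |y|) ^ (-(3/2 : ℝ)) := by
  simpa using integrable_one_add_norm (E := ℝ) (μ := volume) (r := 3/2) (by norm_num)

theorem integrable_heat_kernel {M t : ℝ} (hM : 0 < M) (ht : 0 < t) (z : ℝ) :
    Integrable fun y : ℝ => t ^ (-(1/2 : ℝ)) * exp (-((z - y) ^ 2 / (M * t))) := by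
  refine Integrable.const_mul ?_ _
  have h := (integrable_exp_neg_mul_sq (b := (M * t)⁻¹) (by positivity)).comp_sub_left z
  refine h.congr (Filter.Eventually.of_forall fun y => ?_)
  simp only [div_eq_inv_mul, neg_mul]

theorem integral_heat_kernel {M t : ℝ} (hM : 0 < M) (ht : 0 < t) (z : ℝ) :
    ∫ y : ℝ, t ^ (-(1/2 : ℝ)) * exp (-((z - y) ^ 2 / (M * t))) = √(π * M) := by
  have h := integral_sub_left_eq_self (fun x : ℝ => exp (-(M * t)⁻¹ * x ^ 2)) volume z
  rw [integral_gaussian] at h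
  simp only [neg_mul, ← div_eq_inv_mul, div_inv_eq_mul] at h
  rw [integral_const_mul, h, ← mul_assoc, sqrt_mul (by positivity), rpow_neg ht.le,
    ← sqrt_eq_rpow]
  field_simp

/-- Convolution of a heat kernel with algebraically localized data. -/
theorem heat_kernel_algebraic_convolution (M : ℝ) (hM : 0 < M) :
    ∃ M' > M, ∃ C > 0, ∀ t : ℝ, 0 < t → ∀ z : ℝ,
      ∫ y : ℝ, t ^ (-(1/2 : ℝ)) * Real.exp (-((z - y) ^ 2 / (M * t))) *
          (1 + |y|) ^ (-(3/2 : ℝ))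
        ≤ C * ((1 + |z| + Real.sqrt t) ^ (-(3/2 : ℝ)) +
            (1 + t) ^ (-(1/2 : ℝ)) * Real.exp (-(z ^ 2 / (M' * t)))) := by
  set D := ∫ y : ℝ, (1 + |y|) ^ (-(3/2 : ℝ)) with hD
  set K := √(π * M) with hK
  have hD0 : 0 ≤ D := integral_nonneg fun y => by positivity
  have hK0 : 0 < K := by positivity
  refine ⟨4 * M, by linarith, 64 * (M * D) + 16 * K + 2 * D + 2 * D * exp (1 / (4 * M)),
    by positivity, fun t ht z => ?_⟩
  set I := ∫ y : ℝ, t ^ (-(1/2 : ℝ)) * Real.exp (-((z - y) ^ 2 / (M * t))) *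
          (1 + |y|) ^ (-(3/2 : ℝ)) with hI
  set s := t ^ (-(1/2 : ℝ)) with hs
  set E := exp (-(z ^ 2 / (4 * M * t))) with hE
  set A := (1 + |z|) ^ (-(3/2 : ℝ)) with hA
  set B := (1 + |z| + √t) ^ (-(3/2 : ℝ)) with hB
  set S := (1 + t) ^ (-(1/2 : ℝ)) with hS
  have hs0 : 0 < s := by positivity
  have hE0 : 0 < E := exp_pos _
  have hA0 : 0 < A := by positivity
  have hB0 : 0 < B := by positivity
  have hS0 : 0 < S := by positivity
  have hz0 := abs_nonneg z
  have hpos : ∀ y : ℝ, 0 ≤ s * exp (-((z - y) ^ 2 / (M * t))) * (1 + |y|) ^ (-(3/2 : ℝ)) :=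
    fun y => by positivity
  have hker := integrable_heat_kernel hM ht z
  have hdat := integrable_one_add_abs_rpow_neg_three_halves
  have hIK : I ≤ K := by
    rw [hK, ← integral_heat_kernel hM ht z]
    refine integral_mono_of_nonneg (.of_forall hpos) hker (.of_forall fun y => ?_)
    refine mul_le_of_le_one_right (by positivity) ?_
    exact rpow_le_one_of_one_le_of_nonpos (by linarith [abs_nonneg y]) (by norm_num)
  have hID : I ≤ s * D := by
    rw [hD, ← integral_const_mul]
    refine integral_mono_of_nonneg (.of_forall hpos) (hdat.const_mul s) (.of_forall fun y => ?_)
    have : exp (-((z - y) ^ 2 / (M * t))) ≤ 1 :=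
      exp_le_one_iff.2 (neg_nonpos.2 (by positivity))
    exact mul_le_mul_of_nonneg_right (mul_le_of_le_one_right hs0.le this) (by positivity)
  have hIsplit : I ≤ s * E * D + 4 * A * K := by
    rw [hD, hK, ← integral_heat_kernel hM ht z, ← integral_const_mul, ← integral_const_mul,
      ← integral_add (hdat.const_mul _) (hker.const_mul _)]
    refine integral_mono_of_nonneg (.of_forall hpos)
      ((hdat.const_mul _).add (hker.const_mul _)) (.of_forall fun y => ?_)
    have hy0 := abs_nonneg y
    rcases le_total (2 * |y|) |z| with hy | hy
    · refine le_add_of_le_of_nonneg ?_ (by positivity)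
      refine mul_le_mul_of_nonneg_right (mul_le_mul_of_nonneg_left ?_ hs0.le) (by positivity)
      refine exp_le_exp.2 (neg_le_neg ?_)
      have h2 : |z| ≤ 2 * |z - y| := by linarith [abs_sub_abs_le_abs_sub z y]
      rw [div_le_div_iff₀ (by positivity) (by positivity), ← sq_abs z, ← sq_abs (z - y)]
      have h4 : |z| ^ 2 ≤ 4 * |z - y| ^ 2 := by nlinarith
      nlinarith [mul_le_mul_of_nonneg_right h4 (mul_pos hM ht).le]
    · refine le_add_of_nonneg_of_le (by positivity) ?_
      have h := rpow_neg_three_halves_le_four_mul (a := 1 + |z|) (b := 1 + |y|)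
        (by positivity) (by linarith)
      exact (mul_comm _ _).trans_le (mul_le_mul_of_nonneg_right h (by positivity))
  rcases le_total t 1 with ht1 | ht1
  · have hAB : A ≤ 4 * B := rpow_neg_three_halves_le_four_mul (by positivity)
      (by linarith [sqrt_le_one.2 ht1])
    rcases le_total |z| 1 with hz | hz
    · have h1A : 1 ≤ 4 * A := by
        simpa using rpow_neg_three_halves_le_four_mul (a := 1 + |z|) (b := 1)
          (by positivity) (by linarith)
      have h2 : K * 1 ≤ K * (4 * (4 * B)) := by
        gcongr
        linarith
      have h3 : 0 ≤ (64 * (M * D) + 2 * D + 2 * D * exp (1 / (4 * M))) * B := by positivity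
      have h4 : 0 ≤ (64 * (M * D) + 16 * K + 2 * D + 2 * D * exp (1 / (4 * M))) * (S * E) := by
        positivity
      linarith
    · have hsE : s * E ≤ 16 * M * A := by
        have hst : s * t ≤ 1 := by
          rw [hs, ← rpow_add_one ht.ne']
          exact rpow_le_one ht.le ht1 (by norm_num)
        have hEz : E * z ^ 2 ≤ 4 * M * t := by
          have h := mul_exp_neg_le_exp_neg_one (z ^ 2 / (4 * M * t))
          have h1 : exp (-1 : ℝ) ≤ 1 := exp_le_one_iff.2 (by norm_num)
          rw [div_mul_eq_mul_div, div_le_iff₀ (by positivity)] at h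
          nlinarith [mul_le_mul_of_nonneg_right h1 (by positivity : 0 ≤ 4 * M * t)]
        have hAz : 1 ≤ A * (4 * z ^ 2) := by
          have h1 : 1 ≤ A * (1 + |z|) ^ 2 := by
            rw [hA, ← rpow_natCast (1 + |z|) 2, ← rpow_add (by positivity)]
            exact one_le_rpow (by linarith) (by norm_num)
          refine h1.trans (mul_le_mul_of_nonneg_left ?_ hA0.le)
          nlinarith [sq_abs z]
        calc s * E ≤ s * E * (A * (4 * z ^ 2)) := le_mul_of_one_le_right (by positivity) hAz
          _ = 4 * A * s * (E * z ^ 2) := by ring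
          _ ≤ 4 * A * s * (4 * M * t) := by gcongr
          _ = 16 * M * A * (s * t) := by ring
          _ ≤ 16 * M * A := mul_le_of_le_one_right (by positivity) hst
      have : I ≤ 16 * M * A * D + 4 * A * K :=
        hIsplit.trans (by gcongr)
      have h2 : A * (16 * (M * D) + 4 * K) ≤ 4 * B * (16 * (M * D) + 4 * K) := by gcongr
      have h3 : 0 ≤ (2 * D + 2 * D * exp (1 / (4 * M))) * B := by positivity
      have h4 : 0 ≤ (64 * (M * D) + 16 * K + 2 * D + 2 * D * exp (1 / (4 * M))) * (S * E) := by
        positivity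
      linarith
  · have hsS : s ≤ 2 * S := by
      have h : (2 ^ 2 * t) ^ (-(1/2 : ℝ)) ≤ S :=
        rpow_le_rpow_of_nonpos (by positivity) (by linarith) (by norm_num)
      rw [mul_rpow (by positivity) ht.le, rpow_neg (by positivity), ← sqrt_eq_rpow,
        sqrt_sq zero_le_two] at h
      linarith
    rcases le_total |z| (√t) with hz | hz
    · have h1E : 1 ≤ exp (1 / (4 * M)) * E := by
        rw [hE, ← exp_add]
        refine one_le_exp ?_
        have : z ^ 2 ≤ t := by
          rw [← sq_abs, ← sq_sqrt ht.le]; gcongr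
        rw [← sub_eq_add_neg, sub_nonneg, div_le_div_iff₀ (by positivity) (by positivity)]
        nlinarith
      have h2 : s * D ≤ 2 * S * (exp (1 / (4 * M)) * E) * D := by
        gcongr
        nlinarith
      have h3 : 0 ≤ (64 * (M * D) + 16 * K + 2 * D) * (S * E) := by positivity
      have h4 : 0 ≤ (64 * (M * D) + 16 * K + 2 * D + 2 * D * exp (1 / (4 * M))) * B := by
        positivity
      linarith
    · have hAB : A ≤ 4 * B := rpow_neg_three_halves_le_four_mul (by positivity) (by linarith)
      have h2 : s * E * D + 4 * A * K ≤ 2 * S * E * D + 4 * (4 * B) * K := by gcongr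
      have h3 : 0 ≤ (64 * (M * D) + 2 * D + 2 * D * exp (1 / (4 * M))) * B := by positivity
      have h4 : 0 ≤ (64 * (M * D) + 16 * K + 2 * D * exp (1 / (4 * M))) * (S * E) := by
        positivity
      linarith
end

section
/- There exists a constant C > 0 (depending only on a₁,…,a_m and M') such that for every j ∈ {1,…,m}, every x ∈ ℝ and every t > 0: (1+|x−a_j t|+√t)^{−3/2} ≤ C (θ + ψ₁ + ψ₂)(x,t). -/
open MeasureTheory Real

/-- The Gaussian-weight sum `θ`. -/
noncomputable def theta (m : ℕ) (a : Fin m → ℝ) (M' : ℝ) (x t : ℝ) : ℝ :=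
  ∑ j : Fin m, (1 + t) ^ (-(1/2 : ℝ)) * Real.exp (-((x - a j * t) ^ 2 / (M' * t)))

/-- The indicator `χ` of the characteristic cone `[a₁ t, a_m t]`. -/
noncomputable def chi (a1 am x t : ℝ) : ℝ :=
  if a1 * t ≤ x ∧ x ≤ am * t then 1 else 0

/-- The algebraically decaying weight `ψ₁` supported inside the characteristic cone. -/
noncomputable def psi1 (m : ℕ) (a : Fin m → ℝ) (a1 am x t : ℝ) : ℝ :=
  chi a1 am x t *
    ∑ j : Fin m, (1 + |x| + t) ^ (-(1/2 : ℝ)) * (1 + |x - a j * t|) ^ (-(1/2 : ℝ))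

/-- The weight `ψ₂` supported outside the characteristic cone. -/
noncomputable def psi2 (a1 am x t : ℝ) : ℝ :=
  (1 - chi a1 am x t) *
    ((1 + |x - a1 * t| + Real.sqrt t) ^ (-(3/2 : ℝ)) +
      (1 + |x - am * t| + Real.sqrt t) ^ (-(3/2 : ℝ)))

theorem theta_nonneg (m : ℕ) (a : Fin m → ℝ) (M' x : ℝ) {t : ℝ} (ht : 0 < t) :
    0 ≤ theta m a M' x t :=
  Finset.sum_nonneg fun _ _ => by positivity

/-- If `r ≤ C (1 + t)`, the algebraic weight is bounded by a summand of `ψ₁`. -/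
theorem rpow_neg_three_halves_le {C r y t : ℝ} (hC : 1 ≤ C) (hr : 0 < r) (hy : 0 ≤ y)
    (ht : 0 < t) (h : r ≤ C * (1 + t)) :
    (1 + y + √t) ^ (-(3/2 : ℝ)) ≤ C * (r ^ (-(1/2 : ℝ)) * (1 + y) ^ (-(1/2 : ℝ))) := by
  have hs := Real.sqrt_nonneg t
  have hsq := Real.sq_sqrt ht.le
  set B := 1 + y + √t with hB
  have hB0 : 0 < B := by positivity
  have hC0 : 0 < C := by linarith
  have hsplit : B ^ (-(3/2 : ℝ)) = B⁻¹ * B ^ (-(1/2 : ℝ)) := by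
    rw [← Real.rpow_neg_one, ← Real.rpow_add hB0]
    norm_num
  have hfar : B ^ (-(1/2 : ℝ)) ≤ (1 + y) ^ (-(1/2 : ℝ)) :=
    Real.rpow_le_rpow_of_nonpos (by positivity) (by linarith) (by norm_num)
  have hle : r ≤ (C * B) ^ 2 := by
    have hB2 : 1 + t ≤ B ^ 2 := by nlinarith [mul_nonneg hy hs]
    calc r ≤ C * (1 + t) := h
      _ ≤ C * B ^ 2 := by gcongr
      _ ≤ C ^ 2 * B ^ 2 := by gcongr; nlinarith
      _ = (C * B) ^ 2 := by ring
  have hinv : (C * B)⁻¹ ≤ r ^ (-(1/2 : ℝ)) := by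
    calc (C * B)⁻¹ = ((C * B) ^ 2) ^ (-(1/2 : ℝ)) := by
          rw [← Real.rpow_natCast, ← Real.rpow_mul (by positivity), ← Real.rpow_neg_one]
          norm_num
      _ ≤ r ^ (-(1/2 : ℝ)) := Real.rpow_le_rpow_of_nonpos hr hle (by norm_num)
  calc B ^ (-(3/2 : ℝ)) = C * ((C * B)⁻¹ * B ^ (-(1/2 : ℝ))) := by
        rw [hsplit]
        field_simp
    _ ≤ C * (r ^ (-(1/2 : ℝ)) * (1 + y) ^ (-(1/2 : ℝ))) := by gcongr

/-- `(1+|x−a_j t|+√t)^{−3/2}` is dominated by `θ + ψ₁ + ψ₂`. -/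
theorem algebraic_decay_le_weights (m : ℕ) (hm : 2 ≤ m) (a : Fin m → ℝ)
    (ha : StrictMono a) (M' : ℝ) (hM' : 0 < M') :
    ∃ C > 0, ∀ j : Fin m, ∀ x t : ℝ, 0 < t →
      (1 + |x - a j * t| + Real.sqrt t) ^ (-(3/2 : ℝ)) ≤
        C * (theta m a M' x t +
          psi1 m a (a ⟨0, by omega⟩) (a ⟨m - 1, by omega⟩) x t +
          psi2 (a ⟨0, by omega⟩) (a ⟨m - 1, by omega⟩) x t) := by
  set p : Fin m := ⟨0, by omega⟩ with hp
  set q : Fin m := ⟨m - 1, by omega⟩ with hq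
  have hK (i : Fin m) : |a i| ≤ ∑ k, |a k| :=
    Finset.single_le_sum (f := fun k => |a k|) (fun _ _ => abs_nonneg _) (Finset.mem_univ i)
  set K := ∑ k, |a k|
  have hK0 : 0 ≤ K := (abs_nonneg _).trans (hK p)
  refine ⟨K + 1, by positivity, fun j x t ht => ?_⟩
  have hθ := theta_nonneg m a M' x ht
  have hpj : a p * t ≤ a j * t :=
    mul_le_mul_of_nonneg_right (ha.monotone (Fin.le_def.2 (Nat.zero_le _))) ht.le
  have hjq : a j * t ≤ a q * t :=
    mul_le_mul_of_nonneg_right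
      (ha.monotone (Fin.le_def.2 (Nat.le_sub_one_of_lt j.isLt))) ht.le
  by_cases h : a p * t ≤ x ∧ x ≤ a q * t
  · simp only [psi1, psi2, chi, if_pos h, one_mul, sub_self, zero_mul, add_zero]
    have hx : |x| ≤ K * t := by
      have h1 := mul_le_mul_of_nonneg_right (neg_le_of_abs_le (hK p)) ht.le
      have h2 := mul_le_mul_of_nonneg_right (le_of_abs_le (hK q)) ht.le
      exact abs_le.2 ⟨by linarith [h.1], by linarith [h.2]⟩
    refine (rpow_neg_three_halves_le (C := K + 1) (r := 1 + |x| + t) (by linarith)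
      (by positivity) (abs_nonneg _) ht (by nlinarith)).trans ?_
    gcongr
    refine le_add_of_nonneg_of_le hθ ?_
    exact Finset.single_le_sum
      (f := fun k => (1 + |x| + t) ^ (-(1/2 : ℝ)) * (1 + |x - a k * t|) ^ (-(1/2 : ℝ)))
      (fun _ _ => by positivity) (Finset.mem_univ j)
  · simp only [psi1, psi2, chi, if_neg h, one_mul, sub_zero, zero_mul, add_zero]
    have mono {c : ℝ} (hc : |x - c * t| ≤ |x - a j * t|) :
        (1 + |x - a j * t| + √t) ^ (-(3/2 : ℝ)) ≤ (1 + |x - c * t| + √t) ^ (-(3/2 : ℝ)) :=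
      Real.rpow_le_rpow_of_nonpos (by positivity) (by linarith) (by norm_num)
    have hpos (c : ℝ) : 0 ≤ (1 + |x - c * t| + √t) ^ (-(3/2 : ℝ)) := by positivity
    have key : (1 + |x - a j * t| + √t) ^ (-(3/2 : ℝ)) ≤
        (1 + |x - a p * t| + √t) ^ (-(3/2 : ℝ)) + (1 + |x - a q * t| + √t) ^ (-(3/2 : ℝ)) := by
      rcases lt_or_ge x (a p * t) with hx | hx
      · refine le_add_of_le_of_nonneg (mono ?_) (hpos _)
        rw [abs_of_nonpos (by linarith), abs_of_nonpos (by linarith)]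
        linarith
      · have hx' : a q * t < x := not_le.1 fun h' => h ⟨hx, h'⟩
        refine le_add_of_nonneg_of_le (hpos _) (mono ?_)
        rw [abs_of_nonneg (by linarith), abs_of_nonneg (by linarith)]
        linarith
    refine (key.trans (le_add_of_nonneg_left hθ)).trans ?_
    exact le_mul_of_one_le_left
      (add_nonneg hθ (add_nonneg (hpos _) (hpos _))) (by linarith)
end

section
/- For every real d ≠ 0, every N > 0 and every M' ≥ 4N there exists C > 0 such that for all X ∈ ℝ, s ≥ 0, t ≥ 0: (1+s)^{−1/2} exp(−(X+ds)²/(N(1+t))) ≤ C [ (1+|X|)^{−1/2} exp(−(X+ds)²/(N(1+t))) + (1+s)^{−1/2} exp(−X²/(M'(1+t))) ]. -/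
open Real

/-- If `a` is at most a multiple `K` of `b`, inverse square-root decay in `b` can be traded for
decay in `a`. -/
theorem rpow_neg_half_le_of_le_mul {a b K : ℝ} (ha : 0 < a) (hb : 0 < b) (hK : 0 < K)
    (h : a ≤ K * b) : b ^ (-(1/2 : ℝ)) ≤ K ^ (1/2 : ℝ) * a ^ (-(1/2 : ℝ)) := by
  have h₁ : (K * b) ^ (-(1/2 : ℝ)) ≤ a ^ (-(1/2 : ℝ)) :=
    Real.rpow_le_rpow_of_nonpos ha h (by norm_num)
  rw [Real.mul_rpow hK.le hb.le] at h₁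
  calc b ^ (-(1/2 : ℝ))
      = K ^ (1/2 : ℝ) * (K ^ (-(1/2 : ℝ)) * b ^ (-(1/2 : ℝ))) := by
        rw [← mul_assoc, ← Real.rpow_add hK]; simp
    _ ≤ K ^ (1/2 : ℝ) * a ^ (-(1/2 : ℝ)) := by gcongr

/-- If `Y` is at most half as large as `X`, the Gaussian in `X + Y` is controlled by a wider
Gaussian in `X`. -/
theorem exp_neg_sq_add_div_le {X Y N M T : ℝ} (hN : 0 < N) (hM : 4 * N ≤ M) (hT : 0 < T)
    (h : 2 * |Y| ≤ |X|) :
    Real.exp (-((X + Y) ^ 2 / (N * T))) ≤ Real.exp (-(X ^ 2 / (M * T))) := by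
  have h₁ : |X| ≤ |2 * (X + Y)| := by
    have h₂ := abs_sub_abs_le_abs_sub X (-Y)
    rw [abs_neg, sub_neg_eq_add] at h₂
    rw [abs_mul, abs_two]
    linarith
  have hsq : X ^ 2 ≤ 4 * (X + Y) ^ 2 := by nlinarith [sq_le_sq.mpr h₁]
  refine Real.exp_le_exp.mpr (neg_le_neg ?_)
  calc X ^ 2 / (M * T) ≤ 4 * (X + Y) ^ 2 / (4 * N * T) := by gcongr
    _ = (X + Y) ^ 2 / (N * T) := by field_simp

/-- The balance estimate trading algebraic decay in `s` against Gaussian decay. -/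
theorem balance_estimate (d N M' : ℝ) (hd : d ≠ 0) (hN : 0 < N) (hM' : 4 * N ≤ M') :
    ∃ C > 0, ∀ X s t : ℝ, 0 ≤ s → 0 ≤ t →
      (1 + s) ^ (-(1/2 : ℝ)) * Real.exp (-((X + d * s) ^ 2 / (N * (1 + t))))
        ≤ C * ((1 + |X|) ^ (-(1/2 : ℝ)) * Real.exp (-((X + d * s) ^ 2 / (N * (1 + t)))) +
            (1 + s) ^ (-(1/2 : ℝ)) * Real.exp (-(X ^ 2 / (M' * (1 + t))))) := by
  have hK : 1 ≤ 1 + 2 * |d| := by linarith [abs_nonneg d]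
  have hC : 1 ≤ (1 + 2 * |d|) ^ (1/2 : ℝ) := Real.one_le_rpow hK (by norm_num)
  refine ⟨(1 + 2 * |d|) ^ (1/2 : ℝ), by positivity, fun X s t hs ht => ?_⟩
  rcases le_total (2 * |d * s|) |X| with h | h
  · have hexp := exp_neg_sq_add_div_le hN hM' (by linarith : 0 < 1 + t) h
    refine le_trans ?_ (le_mul_of_one_le_left (by positivity) hC)
    exact le_add_of_nonneg_of_le (by positivity) (by gcongr)
  · rw [abs_mul, abs_of_nonneg hs] at h
    have hle : 1 + |X| ≤ (1 + 2 * |d|) * (1 + s) := by nlinarith [abs_nonneg d]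
    have hrpow := rpow_neg_half_le_of_le_mul (by positivity) (by positivity) (by positivity) hle
    rw [mul_add ((1 + 2 * |d|) ^ (1/2 : ℝ)), ← mul_assoc]
    exact le_add_of_le_of_nonneg (by gcongr) (by positivity)
end

section
/- Let n ≥ 1 and let f : ℝⁿ → ℝⁿ be smooth. Let ū : ℝ → ℝⁿ be a smooth standing-wave profile, i.e. ū''(x) + (d/dx)[f(ū(x))] = 0 for all x. Let ũ : ℝ × ℝ → ℝⁿ be a smooth solution of ∂_t ũ = ∂_x² ũ + ∂_x (f(ũ)), and let φ : ℝ × ℝ → ℝ be smooth with ∂_x φ(x,t) ≠ 1 for all (x,t). Define v(x,t) = ũ(x − φ(x,t), t) − ū(x) and the linear operator (L w)(x,t) = ∂_x² w(x,t) + ∂_x (df(ū(x)) w(x,t)). Then for all (x,t): (∂_t − L)v = −(∂_t − L)(ū'(x) φ(x,t)) + ∂_x Q + ∂_x R + (∂_x² + ∂_t) S, where Q(x,t) = f(v(x,t) + ū(x)) − f(ū(x)) − df(ū(x)) v(x,t), R(x,t) = −v ∂_t φ − v ∂_x² φ + (ū'(x) + ∂_x v) (∂_x φ)² / (1 − ∂_x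 φ), and S(x,t) = v(x,t) ∂_x φ(x,t). -/
open Real

/-- Partial derivative in the first (spatial) variable. -/
noncomputable def pdx {V : Type*} [NormedAddCommGroup V] [NormedSpace ℝ V]
    (w : ℝ → ℝ → V) (x t : ℝ) : V :=
  deriv (fun x' => w x' t) x

/-- Partial derivative in the second (time) variable. -/
noncomputable def pdt {V : Type*} [NormedAddCommGroup V] [NormedSpace ℝ V]
    (w : ℝ → ℝ → V) (x t : ℝ) : V :=
  deriv (fun t' => w x t') t

section PartialDerivatives

variable {V : Type*} [NormedAddCommGroup V] [NormedSpace ℝ V]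

theorem hasDerivAt_prodMk_const (x t : ℝ) :
    HasDerivAt (fun x' : ℝ => (x', t)) ((1 : ℝ), (0 : ℝ)) x :=
  (hasDerivAt_id x).prodMk (hasDerivAt_const x t)

theorem hasDerivAt_const_prodMk (x t : ℝ) :
    HasDerivAt (fun t' : ℝ => (x, t')) ((0 : ℝ), (1 : ℝ)) t :=
  (hasDerivAt_const t x).prodMk (hasDerivAt_id t)

/-- Joint smoothness of a function of the space and time variables. -/
def JointlySmooth (w : ℝ → ℝ → V) : Prop :=
  ContDiff ℝ (⊤ : ℕ∞) (fun p : ℝ × ℝ => w p.1 p.2)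

namespace JointlySmooth

variable {w z : ℝ → ℝ → V} {a : ℝ → ℝ → ℝ}

theorem differentiable (hw : JointlySmooth w) :
    Differentiable ℝ (fun p : ℝ × ℝ => w p.1 p.2) :=
  ContDiff.differentiable hw (by simp)

theorem hasDerivAt_fst (hw : JointlySmooth w) (x t : ℝ) :
    HasDerivAt (fun x' => w x' t) (fderiv ℝ (fun p : ℝ × ℝ => w p.1 p.2) (x, t) (1, 0)) x :=
  HasFDerivAt.comp_hasDerivAt (f := fun x' => (x', t)) x (hw.differentiable (x, t)).hasFDerivAt
    (hasDerivAt_prodMk_const x t)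

theorem hasDerivAt_snd (hw : JointlySmooth w) (x t : ℝ) :
    HasDerivAt (fun t' => w x t') (fderiv ℝ (fun p : ℝ × ℝ => w p.1 p.2) (x, t) (0, 1)) t :=
  HasFDerivAt.comp_hasDerivAt (f := fun t' => (x, t')) t (hw.differentiable (x, t)).hasFDerivAt
    (hasDerivAt_const_prodMk x t)

theorem pdx_eq (hw : JointlySmooth w) (x t : ℝ) :
    _root_.pdx w x t = fderiv ℝ (fun p : ℝ × ℝ => w p.1 p.2) (x, t) (1, 0) :=
  (hw.hasDerivAt_fst x t).deriv

theorem pdt_eq (hw : JointlySmooth w) (x t : ℝ) :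
    _root_.pdt w x t = fderiv ℝ (fun p : ℝ × ℝ => w p.1 p.2) (x, t) (0, 1) :=
  (hw.hasDerivAt_snd x t).deriv

theorem hasDerivAt_pdx (hw : JointlySmooth w) (x t : ℝ) :
    HasDerivAt (fun x' => w x' t) (_root_.pdx w x t) x :=
  (hw.hasDerivAt_fst x t).differentiableAt.hasDerivAt

theorem hasDerivAt_pdt (hw : JointlySmooth w) (x t : ℝ) :
    HasDerivAt (fun t' => w x t') (_root_.pdt w x t) t :=
  (hw.hasDerivAt_snd x t).differentiableAt.hasDerivAt

theorem contDiff_fderiv (hw : JointlySmooth w) :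
    ContDiff ℝ (⊤ : ℕ∞) (fderiv ℝ (fun p : ℝ × ℝ => w p.1 p.2)) :=
  ContDiff.fderiv_right hw (by simp)

theorem pdx (hw : JointlySmooth w) : JointlySmooth (pdx w) := by
  have h : ContDiff ℝ (⊤ : ℕ∞)
      (fun q : ℝ × ℝ => fderiv ℝ (fun p : ℝ × ℝ => w p.1 p.2) q (1, 0)) :=
    hw.contDiff_fderiv.clm_apply contDiff_const
  simpa only [JointlySmooth, hw.pdx_eq] using h

theorem pdt (hw : JointlySmooth w) : JointlySmooth (pdt w) := by
  have h : ContDiff ℝ (⊤ : ℕ∞)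
      (fun q : ℝ × ℝ => fderiv ℝ (fun p : ℝ × ℝ => w p.1 p.2) q (0, 1)) :=
    hw.contDiff_fderiv.clm_apply contDiff_const
  simpa only [JointlySmooth, hw.pdt_eq] using h

/-- Mixed partial derivatives of a smooth function commute. -/
theorem pdx_pdt_comm (hw : JointlySmooth w) (x t : ℝ) :
    _root_.pdx (_root_.pdt w) x t = _root_.pdt (_root_.pdx w) x t := by
  have hd : DifferentiableAt ℝ (fderiv ℝ (fun p : ℝ × ℝ => w p.1 p.2)) (x, t) :=
    hw.contDiff_fderiv.differentiable (by simp) _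
  have hx : HasDerivAt (fun x' => fderiv ℝ (fun p : ℝ × ℝ => w p.1 p.2) (x', t))
      (fderiv ℝ (fderiv ℝ (fun p : ℝ × ℝ => w p.1 p.2)) (x, t) (1, 0)) x :=
    HasFDerivAt.comp_hasDerivAt (f := fun x' => (x', t)) x hd.hasFDerivAt
      (hasDerivAt_prodMk_const x t)
  have ht : HasDerivAt (fun t' => fderiv ℝ (fun p : ℝ × ℝ => w p.1 p.2) (x, t'))
      (fderiv ℝ (fderiv ℝ (fun p : ℝ × ℝ => w p.1 p.2)) (x, t) (0, 1)) t :=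
    HasFDerivAt.comp_hasDerivAt (f := fun t' => (x, t')) t hd.hasFDerivAt
      (hasDerivAt_const_prodMk x t)
  have hsymm : IsSymmSndFDerivAt ℝ (fun p : ℝ × ℝ => w p.1 p.2) (x, t) :=
    (ContDiff.contDiffAt hw).isSymmSndFDerivAt (by
      rw [minSmoothness_of_isRCLikeNormedField]
      exact WithTop.coe_le_coe.mpr (le_top : (2 : ℕ∞) ≤ ⊤))
  have ex : (fun x' => _root_.pdt w x' t) =
      fun x' => fderiv ℝ (fun p : ℝ × ℝ => w p.1 p.2) (x', t) (0, 1) :=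
    funext fun x' => hw.pdt_eq x' t
  have et : (fun t' => _root_.pdx w x t') =
      fun t' => fderiv ℝ (fun p : ℝ × ℝ => w p.1 p.2) (x, t') (1, 0) :=
    funext fun t' => hw.pdx_eq x t'
  change deriv (fun x' => _root_.pdt w x' t) x = deriv (fun t' => _root_.pdx w x t') t
  rw [ex, et]
  rw [(hx.clm_apply (hasDerivAt_const x ((0 : ℝ), (1 : ℝ)))).deriv,
    (ht.clm_apply (hasDerivAt_const t ((1 : ℝ), (0 : ℝ)))).deriv]
  simpa only [map_zero, add_zero] using hsymm.eq (1, 0) (0, 1)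

theorem add (hw : JointlySmooth w) (hz : JointlySmooth z) :
    JointlySmooth fun x t => w x t + z x t :=
  ContDiff.add hw hz

theorem sub (hw : JointlySmooth w) (hz : JointlySmooth z) :
    JointlySmooth fun x t => w x t - z x t :=
  ContDiff.sub hw hz

theorem smul (ha : JointlySmooth a) (hw : JointlySmooth w) :
    JointlySmooth fun x t => a x t • w x t :=
  ContDiff.smul ha hw

theorem of_fst {u : ℝ → V} (hu : ContDiff ℝ (⊤ : ℕ∞) u) : JointlySmooth fun x _ => u x :=
  hu.comp contDiff_fst

theorem pdx_add (hw : JointlySmooth w) (hz : JointlySmooth z) (x t : ℝ) :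
    _root_.pdx (fun x t => w x t + z x t) x t = _root_.pdx w x t + _root_.pdx z x t :=
  ((hw.hasDerivAt_pdx x t).add (hz.hasDerivAt_pdx x t)).deriv

theorem pdx_sub (hw : JointlySmooth w) (hz : JointlySmooth z) (x t : ℝ) :
    _root_.pdx (fun x t => w x t - z x t) x t = _root_.pdx w x t - _root_.pdx z x t :=
  ((hw.hasDerivAt_pdx x t).sub (hz.hasDerivAt_pdx x t)).deriv

theorem pdx_smul (ha : JointlySmooth a) (hw : JointlySmooth w) (x t : ℝ) :
    _root_.pdx (fun x t => a x t • w x t) x t =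
      a x t • _root_.pdx w x t + _root_.pdx a x t • w x t :=
  ((ha.hasDerivAt_pdx x t).smul (hw.hasDerivAt_pdx x t)).deriv

theorem pdt_smul (ha : JointlySmooth a) (hw : JointlySmooth w) (x t : ℝ) :
    _root_.pdt (fun x t => a x t • w x t) x t =
      a x t • _root_.pdt w x t + _root_.pdt a x t • w x t :=
  ((ha.hasDerivAt_pdt x t).smul (hw.hasDerivAt_pdt x t)).deriv

theorem comp_shift (hw : JointlySmooth w) (ha : JointlySmooth a) :
    JointlySmooth fun x t => w (x - a x t) t :=
  ContDiff.comp (g := fun p : ℝ × ℝ => w p.1 p.2) (f := fun p : ℝ × ℝ => (p.1 - a p.1 p.2, p.2))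
    hw ((contDiff_fst.sub ha).prodMk contDiff_snd)

theorem pdx_comp_shift (hw : JointlySmooth w) (ha : JointlySmooth a) (x t : ℝ) :
    _root_.pdx (fun x t => w (x - a x t) t) x t =
      (1 - _root_.pdx a x t) • _root_.pdx w (x - a x t) t :=
  (HasDerivAt.scomp (h := fun x' => x' - a x' t) x (hw.hasDerivAt_pdx (x - a x t) t)
    ((hasDerivAt_id x).sub (ha.hasDerivAt_pdx x t))).deriv

theorem pdt_comp_shift (hw : JointlySmooth w) (ha : JointlySmooth a) (x t : ℝ) :
    _root_.pdt (fun x t => w (x - a x t) t) x t =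
      _root_.pdt w (x - a x t) t - _root_.pdt a x t • _root_.pdx w (x - a x t) t := by
  have h := HasFDerivAt.comp_hasDerivAt (f := fun t' => (x - a x t', t')) t
    (hw.differentiable (x - a x t, t)).hasFDerivAt
    (((hasDerivAt_const t x).sub (ha.hasDerivAt_pdt x t)).prodMk (hasDerivAt_id t))
  refine h.deriv.trans ?_
  rw [hw.pdt_eq, hw.pdx_eq, ← map_smul, ← map_sub]
  simp

end JointlySmooth

end PartialDerivatives

/-- The nonlinear perturbation equation for the modulated perturbation
`v(x,t) = ũ(x−φ(x,t),t) − ū(x)` of a standing wave of `u_t = u_{xx} + f(u)_x`. -/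
theorem nonlinear_perturbation_equation (n : ℕ) (hn : 1 ≤ n)
    (f : (Fin n → ℝ) → (Fin n → ℝ)) (hf : ContDiff ℝ (⊤ : ℕ∞) f)
    (ubar : ℝ → (Fin n → ℝ)) (hubar : ContDiff ℝ (⊤ : ℕ∞) ubar)
    (hprofile : ∀ x : ℝ, deriv (deriv ubar) x + deriv (fun x' => f (ubar x')) x = 0)
    (ut : ℝ → ℝ → (Fin n → ℝ)) (hut : ContDiff ℝ (⊤ : ℕ∞) (fun p : ℝ × ℝ => ut p.1 p.2))
    (hpde : ∀ x t : ℝ, pdt ut x t = pdx (pdx ut) x t + pdx (fun x' t' => f (ut x' t')) x t)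
    (φ : ℝ → ℝ → ℝ) (hφ : ContDiff ℝ (⊤ : ℕ∞) (fun p : ℝ × ℝ => φ p.1 p.2))
    (hφx : ∀ x t : ℝ, pdx φ x t ≠ 1) :
    letI v : ℝ → ℝ → (Fin n → ℝ) := fun x t => ut (x - φ x t) t - ubar x
    letI L : (ℝ → ℝ → (Fin n → ℝ)) → ℝ → ℝ → (Fin n → ℝ) := fun w x t =>
      pdx (pdx w) x t + pdx (fun x' t' => fderiv ℝ f (ubar x') (w x' t')) x t
    letI E : ℝ → ℝ → (Fin n → ℝ) := fun x t => φ x t • deriv ubar x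
    letI Q : ℝ → ℝ → (Fin n → ℝ) := fun x t =>
      f (v x t + ubar x) - f (ubar x) - fderiv ℝ f (ubar x) (v x t)
    letI R : ℝ → ℝ → (Fin n → ℝ) := fun x t =>
      -(pdt φ x t) • v x t - (pdx (pdx φ) x t) • v x t +
        ((pdx φ x t) ^ 2 / (1 - pdx φ x t)) • (deriv ubar x + pdx v x t)
    letI S : ℝ → ℝ → (Fin n → ℝ) := fun x t => (pdx φ x t) • v x t
    ∀ x t : ℝ,
      pdt v x t - L v x t =
        -(pdt E x t - L E x t) + pdx Q x t + pdx R x t + (pdx (pdx S) x t + pdt S x t) := by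
  intro x t
  let v : ℝ → ℝ → (Fin n → ℝ) := fun x t => ut (x - φ x t) t - ubar x
  let E : ℝ → ℝ → (Fin n → ℝ) := fun x t => φ x t • deriv ubar x
  let Q : ℝ → ℝ → (Fin n → ℝ) := fun x t =>
    f (v x t + ubar x) - f (ubar x) - fderiv ℝ f (ubar x) (v x t)
  let R : ℝ → ℝ → (Fin n → ℝ) := fun x t =>
    -(pdt φ x t) • v x t - (pdx (pdx φ) x t) • v x t +
      ((pdx φ x t) ^ 2 / (1 - pdx φ x t)) • (deriv ubar x + pdx v x t)
  let S : ℝ → ℝ → (Fin n → ℝ) := fun x t => (pdx φ x t) • v x t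
  change pdt v x t -
      (pdx (pdx v) x t + pdx (fun x t => fderiv ℝ f (ubar x) (v x t)) x t) =
    -(pdt E x t - (pdx (pdx E) x t + pdx (fun x t => fderiv ℝ f (ubar x) (E x t)) x t)) +
      pdx Q x t + pdx R x t + (pdx (pdx S) x t + pdt S x t)
  have hU : JointlySmooth ut := hut
  have hP : JointlySmooth φ := hφ
  have hfu : JointlySmooth fun x t => f (ut x t) := hf.comp hut
  have hw : JointlySmooth fun x t => ut (x - φ x t) t := hU.comp_shift hP
  have hfw : JointlySmooth fun x t => f (ut (x - φ x t) t) := hf.comp hw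
  have hg : JointlySmooth fun x t => pdx ut (x - φ x t) t := hU.pdx.comp_shift hP
  have hb : JointlySmooth fun (x _ : ℝ) => ubar x := .of_fst hubar
  have hfb : JointlySmooth fun (x _ : ℝ) => f (ubar x) := .of_fst (hf.comp hubar)
  have hb' : JointlySmooth fun (x _ : ℝ) => deriv ubar x := hb.pdx
  have hb'' : JointlySmooth fun (x _ : ℝ) => deriv (deriv ubar) x := hb'.pdx
  have hv : JointlySmooth v := hw.sub hb
  have hdfv : JointlySmooth fun x t => fderiv ℝ f (ubar x) (v x t) :=
    ((hf.fderiv_right (m := (⊤ : ℕ∞)) (by simp)).comp (hubar.comp contDiff_fst)).clm_apply hv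
  have vt : pdt v x t = pdt (fun x t => ut (x - φ x t) t) x t := deriv_sub_const _
  have vx (x t : ℝ) : pdx v x t = (1 - pdx φ x t) • pdx ut (x - φ x t) t - deriv ubar x :=
    (hw.pdx_sub hb x t).trans (by rw [hU.pdx_comp_shift hP]; rfl)
  -- the profile equation, with its flux term expanded by the chain rule
  have hdf (x : ℝ) : fderiv ℝ f (ubar x) (deriv ubar x) = -deriv (deriv ubar) x := by
    have h : HasDerivAt (fun x' => f (ubar x')) (fderiv ℝ f (ubar x) (deriv ubar x)) x :=
      (hf.differentiable (by simp) (ubar x)).hasFDerivAt.comp_hasDerivAt x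
        (hubar.differentiable (by simp) x).hasDerivAt
    rw [← h.deriv]
    exact eq_neg_of_add_eq_zero_right (hprofile x)
  have key : (1 - pdx φ x t) • pdt v x t =
      pdx (fun x t => pdx ut (x - φ x t) t) x t + pdx (fun x t => f (ut (x - φ x t) t)) x t
        - pdt φ x t • (1 - pdx φ x t) • pdx ut (x - φ x t) t := by
    rw [vt, hU.pdt_comp_shift hP, hU.pdx.pdx_comp_shift hP, hfu.pdx_comp_shift hP, hpde]
    module
  have hEt : pdt E x t = pdt φ x t • deriv ubar x :=
    ((hP.hasDerivAt_pdt x t).smul_const _).deriv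
  have hEx : pdx E = fun x t => φ x t • deriv (deriv ubar) x + pdx φ x t • deriv ubar x := by
    funext x t
    exact hP.pdx_smul hb' x t
  have hExx : pdx (pdx E) x t =
      pdx (fun x t => φ x t • deriv (deriv ubar) x) x t +
        pdx (fun x t => pdx φ x t • deriv ubar x) x t := by
    rw [hEx]
    exact (hP.smul hb'').pdx_add (hP.pdx.smul hb') x t
  have hdfE : pdx (fun x t => fderiv ℝ f (ubar x) (E x t)) x t =
      -pdx (fun x t => φ x t • deriv (deriv ubar) x) x t := by
    have h : (fun x t => fderiv ℝ f (ubar x) (E x t)) =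
        fun x t => -(φ x t • deriv (deriv ubar) x) := by
      funext x t
      simp only [E, map_smul, hdf, smul_neg]
    rw [h]
    exact deriv.fun_neg
  have hpE : pdx (fun x t => pdx φ x t • deriv ubar x) x t =
      pdx φ x t • deriv (deriv ubar) x + pdx (pdx φ) x t • deriv ubar x :=
    hP.pdx.pdx_smul hb' x t
  have hQ : pdx Q x t = pdx (fun x t => f (ut (x - φ x t) t)) x t + deriv (deriv ubar) x
      - pdx (fun x t => fderiv ℝ f (ubar x) (v x t)) x t := by
    have h : Q = fun x t => f (ut (x - φ x t) t) - f (ubar x) - fderiv ℝ f (ubar x) (v x t) := by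
      funext x t
      simp only [Q, v, sub_add_cancel]
    have hp : pdx (fun (x _ : ℝ) => f (ubar x)) x t = -deriv (deriv ubar) x :=
      eq_neg_of_add_eq_zero_right (hprofile x)
    rw [h, (hfw.sub hfb).pdx_sub hdfv, hfw.pdx_sub hfb, hp, sub_neg_eq_add]
  have hwx : JointlySmooth fun x t => deriv ubar x + pdx v x t := hb'.add hv.pdx
  have hR : R = fun x t => pdx ut (x - φ x t) t - (deriv ubar x + pdx v x t)
      - pdx φ x t • (deriv ubar x + pdx v x t) - pdt φ x t • v x t
      - pdx (pdx φ) x t • v x t := by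
    funext x t
    have h1 : 1 - pdx φ x t ≠ 0 := sub_ne_zero.mpr (hφx x t).symm
    simp only [R, vx, add_sub_cancel, smul_smul, div_mul_cancel₀ _ h1]
    module
  have hRx : pdx R x t = pdx (fun x t => pdx ut (x - φ x t) t) x t
      - (deriv (deriv ubar) x + pdx (pdx v) x t)
      - (pdx φ x t • (deriv (deriv ubar) x + pdx (pdx v) x t)
        + pdx (pdx φ) x t • (deriv ubar x + pdx v x t))
      - (pdt φ x t • pdx v x t + pdx (pdt φ) x t • v x t)
      - (pdx (pdx φ) x t • pdx v x t + pdx (pdx (pdx φ)) x t • v x t) := by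
    rw [hR, (((hg.sub hwx).sub (hP.pdx.smul hwx)).sub (hP.pdt.smul hv)).pdx_sub
        (hP.pdx.pdx.smul hv),
      ((hg.sub hwx).sub (hP.pdx.smul hwx)).pdx_sub (hP.pdt.smul hv),
      (hg.sub hwx).pdx_sub (hP.pdx.smul hwx), hg.pdx_sub hwx, hP.pdx.pdx_smul hwx,
      hP.pdt.pdx_smul hv, hP.pdx.pdx.pdx_smul hv, hb'.pdx_add hv.pdx]
    rfl
  have hSt : pdt S x t = pdx φ x t • pdt v x t + pdt (pdx φ) x t • v x t :=
    hP.pdx.pdt_smul hv x t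
  have hSx : pdx S = fun x t => pdx φ x t • pdx v x t + pdx (pdx φ) x t • v x t := by
    funext x t
    exact hP.pdx.pdx_smul hv x t
  have hSxx : pdx (pdx S) x t =
      (pdx φ x t • pdx (pdx v) x t + pdx (pdx φ) x t • pdx v x t)
        + (pdx (pdx φ) x t • pdx v x t + pdx (pdx (pdx φ)) x t • v x t) := by
    rw [hSx, (hP.pdx.smul hv.pdx).pdx_add (hP.pdx.pdx.smul hv), hP.pdx.pdx_smul hv.pdx,
      hP.pdx.pdx.pdx_smul hv]
  rw [hEt, hExx, hdfE, hpE, hQ, hRx, hSt, hSxx, hP.pdx_pdt_comm]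
  linear_combination (norm := module) key + pdt φ x t • vx x t
end

section
/- Let a ≤ 0 and b, c ∈ ℝ, and let M > 0. Then there exists C > 0 such that for all x ∈ ℝ and all t > 0: ∫₀^t ∫_{as}^{0} (t−s)^{−1} (1+|y|+s)^{−1} (1+|y−bs|)^{−1/2} exp(−(x−y−c(t−s))²/(2M(t−s))) dy ds ≤ C (1+t)^{−1/2}. -/
open MeasureTheory Real intervalIntegral

/-- Monotonicity of the interval integral for nonnegative functions: only the majorant has to be
integrable. -/
lemma intervalIntegral_le_of_nonneg_of_le {f g : ℝ → ℝ} {p q : ℝ} (hpq : p ≤ q)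
    (hf : ∀ u ∈ Set.Ioo p q, 0 ≤ f u) (hg : IntervalIntegrable g volume p q)
    (hfg : ∀ u ∈ Set.Ioo p q, f u ≤ g u) :
    ∫ u in p..q, f u ≤ ∫ u in p..q, g u := by
  rw [integral_of_le hpq, integral_of_le hpq, integral_Ioc_eq_integral_Ioo,
    integral_Ioc_eq_integral_Ioo]
  exact integral_mono_of_nonneg (ae_restrict_of_forall_mem measurableSet_Ioo hf)
    (hg.1.mono_set Set.Ioo_subset_Ioc_self) (ae_restrict_of_forall_mem measurableSet_Ioo hfg)

lemma integral_one_add_rpow_neg_half (t : ℝ) :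
    ∫ s in (0 : ℝ)..t, (1 + s) ^ (-(1 / 2 : ℝ)) = 2 * (√(1 + t) - 1) := by
  rw [integral_comp_add_left (fun s : ℝ ↦ s ^ (-(1 / 2 : ℝ))) 1,
    integral_rpow (Or.inl (by norm_num)), sqrt_eq_rpow]
  norm_num
  ring

lemma integral_sub_rpow_neg_half (t : ℝ) :
    ∫ s in (0 : ℝ)..t, (t - s) ^ (-(1 / 2 : ℝ)) = 2 * √t := by
  rw [integral_comp_sub_left (fun s : ℝ ↦ s ^ (-(1 / 2 : ℝ))) t,
    integral_rpow (Or.inl (by norm_num)), sqrt_eq_rpow]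
  norm_num
  ring

lemma continuous_one_add_abs_sub_rpow (d r : ℝ) :
    Continuous fun y : ℝ ↦ (1 + |y - d|) ^ r :=
  Continuous.rpow_const (by fun_prop) fun y ↦ Or.inl (by positivity)

lemma integral_one_add_abs_rpow_neg_half_le {p q R : ℝ} (hp : -R ≤ p) (hpq : p ≤ q) (hq : q ≤ R) :
    ∫ z in p..q, (1 + |z|) ^ (-(1 / 2 : ℝ)) ≤ 4 * √(1 + R) := by
  have hR : 0 ≤ R := by linarith
  have hcont : Continuous fun z : ℝ ↦ (1 + |z|) ^ (-(1 / 2 : ℝ)) := by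
    simpa using continuous_one_add_abs_sub_rpow 0 (-(1 / 2))
  have hright : ∫ z in (0 : ℝ)..R, (1 + |z|) ^ (-(1 / 2 : ℝ)) = 2 * (√(1 + R) - 1) := by
    rw [← integral_one_add_rpow_neg_half]
    refine integral_congr fun z hz ↦ ?_
    rw [Set.uIcc_of_le hR] at hz
    simp only [abs_of_nonneg hz.1]
  have hleft : ∫ z in (-R)..0, (1 + |z|) ^ (-(1 / 2 : ℝ)) = 2 * (√(1 + R) - 1) := by
    rw [← hright]
    simpa using (integral_comp_neg (a := 0) (b := R)
      (fun z : ℝ ↦ (1 + |z|) ^ (-(1 / 2 : ℝ)))).symm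
  calc ∫ z in p..q, (1 + |z|) ^ (-(1 / 2 : ℝ))
      ≤ ∫ z in (-R)..R, (1 + |z|) ^ (-(1 / 2 : ℝ)) :=
        integral_mono_interval hp hpq hq (Filter.Eventually.of_forall fun z ↦ by positivity)
          (hcont.intervalIntegrable _ _)
    _ = 4 * (√(1 + R) - 1) := by
        rw [← integral_add_adjacent_intervals (hcont.intervalIntegrable (-R) 0)
          (hcont.intervalIntegrable 0 R), hleft, hright]
        ring
    _ ≤ 4 * √(1 + R) := by linarith

lemma integral_cone_one_add_abs_sub_rpow_le (a b : ℝ) (ha : a ≤ 0) {s : ℝ} (hs : 0 ≤ s) :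
    ∫ y in (a * s)..0, (1 + |y - b * s|) ^ (-(1 / 2 : ℝ)) ≤
      4 * √(1 + |a| + |b|) * √(1 + s) := by
  rw [integral_comp_sub_right (fun z : ℝ ↦ (1 + |z|) ^ (-(1 / 2 : ℝ))), mul_assoc,
    ← sqrt_mul (by positivity)]
  have hbs : |b * s| = |b| * s := by rw [abs_mul, abs_of_nonneg hs]
  have has : |a * s| = |a| * s := by rw [abs_mul, abs_of_nonneg hs]
  have hb := abs_le.1 hbs.le
  have ha' := abs_le.1 has.le
  have has_nonneg : 0 ≤ |a| * s := by positivity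
  have has_nonpos : a * s ≤ 0 := mul_nonpos_of_nonpos_of_nonneg ha hs
  refine (integral_one_add_abs_rpow_neg_half_le (R := |a| * s + |b| * s) (by linarith)
    (by linarith) (by linarith)).trans ?_
  gcongr
  nlinarith [abs_nonneg a, abs_nonneg b]

lemma integral_exp_neg_sub_sq_div_le {v : ℝ} (hv : 0 < v) (m : ℝ) {p q : ℝ} (hpq : p ≤ q) :
    ∫ y in p..q, Real.exp (-((m - y) ^ 2 / v)) ≤ √(π * v) := by
  have heq : (fun y : ℝ ↦ Real.exp (-((m - y) ^ 2 / v))) =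
      fun y ↦ (fun z : ℝ ↦ Real.exp (-v⁻¹ * z ^ 2)) (m - y) := by
    ext y
    congr 1
    ring
  have hint : Integrable fun y : ℝ ↦ Real.exp (-((m - y) ^ 2 / v)) := by
    rw [heq]
    exact (integrable_exp_neg_mul_sq (inv_pos.2 hv)).comp_sub_left m
  calc ∫ y in p..q, Real.exp (-((m - y) ^ 2 / v))
      ≤ ∫ y, Real.exp (-((m - y) ^ 2 / v)) := by
        rw [integral_of_le hpq]
        exact setIntegral_le_integral hint (Filter.Eventually.of_forall fun y ↦ (exp_pos _).le)
    _ = √(π * v) := by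
        rw [heq, integral_sub_left_eq_self (fun z : ℝ ↦ Real.exp (-v⁻¹ * z ^ 2)),
          integral_gaussian, div_inv_eq_mul]

lemma rpow_neg_half_eq_inv_sqrt {u : ℝ} (hu : 0 ≤ u) : u ^ (-(1 / 2 : ℝ)) = (√u)⁻¹ := by
  rw [rpow_neg hu, sqrt_eq_rpow]

/-- For `s ≤ t / 2` the cone integral is controlled by the decay off the line `y = b * s`. -/
lemma inner_integral_le_of_le_half (a b c M : ℝ) (ha : a ≤ 0) (hM : 0 < M) (x : ℝ) {s t : ℝ}
    (hs : 0 < s) (hst : s ≤ t / 2) :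
    ∫ y in (a * s)..(0 : ℝ),
        (t - s)⁻¹ * (1 + |y| + s)⁻¹ * (1 + |y - b * s|) ^ (-(1/2 : ℝ)) *
          Real.exp (-((x - y - c * (t - s)) ^ 2 / (2 * M * (t - s)))) ≤
      8 * √(1 + |a| + |b|) / t * (1 + s) ^ (-(1 / 2 : ℝ)) := by
  have ht : 0 < t := by linarith
  have hts : 0 < t - s := by linarith
  have hsqrt : 0 < √(1 + s) := sqrt_pos.2 (by linarith)
  refine (intervalIntegral_le_of_nonneg_of_le (mul_nonpos_of_nonpos_of_nonneg ha hs.le)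
    (g := fun y ↦ (2 / t * (1 + s)⁻¹) * (1 + |y - b * s|) ^ (-(1 / 2 : ℝ)))
    (fun y _ ↦ by positivity)
    ((continuous_one_add_abs_sub_rpow _ _).const_mul _ |>.intervalIntegrable _ _)
    fun y _ ↦ ?_).trans ?_
  · have hinv : (t - s)⁻¹ ≤ 2 / t := by
      rw [inv_le_comm₀ hts (by positivity), inv_div]
      linarith
    have hexp : Real.exp (-((x - y - c * (t - s)) ^ 2 / (2 * M * (t - s)))) ≤ 1 :=
      exp_le_one_iff.2 (neg_nonpos.2 (by positivity))
    refine (mul_le_of_le_one_right (by positivity) hexp).trans ?_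
    gcongr
    linarith [abs_nonneg y]
  · rw [intervalIntegral.integral_const_mul, rpow_neg_half_eq_inv_sqrt (by positivity)]
    calc 2 / t * (1 + s)⁻¹ * ∫ y in (a * s)..0, (1 + |y - b * s|) ^ (-(1 / 2 : ℝ))
        ≤ 2 / t * (1 + s)⁻¹ * (4 * √(1 + |a| + |b|) * √(1 + s)) := by
          gcongr
          exact integral_cone_one_add_abs_sub_rpow_le a b ha hs.le
      _ = 8 * √(1 + |a| + |b|) / t * (√(1 + s))⁻¹ := by
          nth_rewrite 1 [← mul_self_sqrt (show 0 ≤ 1 + s by linarith)]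
          field_simp
          ring

/-- For `t / 2 ≤ s` the cone integral is controlled by the Gaussian factor. -/
lemma inner_integral_le_of_half_le (a b c M : ℝ) (ha : a ≤ 0) (hM : 0 < M) (x : ℝ) {s t : ℝ}
    (hs : 0 < s) (hst : t / 2 ≤ s) (hs_lt : s < t) :
    ∫ y in (a * s)..(0 : ℝ),
        (t - s)⁻¹ * (1 + |y| + s)⁻¹ * (1 + |y - b * s|) ^ (-(1/2 : ℝ)) *
          Real.exp (-((x - y - c * (t - s)) ^ 2 / (2 * M * (t - s)))) ≤
      2 * √(2 * π * M) / (1 + t) * (t - s) ^ (-(1 / 2 : ℝ)) := by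
  have ht : 0 < t := by linarith
  have hts : 0 < t - s := by linarith
  have hsqrt : 0 < √(t - s) := sqrt_pos.2 hts
  have has : a * s ≤ 0 := mul_nonpos_of_nonpos_of_nonneg ha hs.le
  have hcont : Continuous fun y : ℝ ↦
      Real.exp (-((x - c * (t - s) - y) ^ 2 / (2 * M * (t - s)))) := by fun_prop
  refine (intervalIntegral_le_of_nonneg_of_le has
    (g := fun y ↦ ((t - s)⁻¹ * (2 / (1 + t))) *
      Real.exp (-((x - c * (t - s) - y) ^ 2 / (2 * M * (t - s)))))
    (fun y _ ↦ by positivity) (hcont.const_mul _ |>.intervalIntegrable _ _)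
    fun y _ ↦ ?_).trans ?_
  · have hinv : (1 + |y| + s)⁻¹ ≤ 2 / (1 + t) := by
      rw [inv_le_comm₀ (by positivity) (by positivity), inv_div]
      linarith [abs_nonneg y]
    have hone : (1 + |y - b * s|) ^ (-(1/2 : ℝ)) ≤ 1 :=
      rpow_le_one_of_one_le_of_nonpos (by linarith [abs_nonneg (y - b * s)]) (by norm_num)
    rw [sub_right_comm x y]
    refine mul_le_mul_of_nonneg_right ?_ (exp_pos _).le
    refine (mul_le_of_le_one_right (by positivity) hone).trans ?_
    gcongr
  · rw [intervalIntegral.integral_const_mul, rpow_neg_half_eq_inv_sqrt hts.le]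
    calc (t - s)⁻¹ * (2 / (1 + t)) * ∫ y in (a * s)..0,
            Real.exp (-((x - c * (t - s) - y) ^ 2 / (2 * M * (t - s))))
        ≤ (t - s)⁻¹ * (2 / (1 + t)) * √(π * (2 * M * (t - s))) := by
          gcongr
          exact integral_exp_neg_sub_sq_div_le (by positivity) _ has
      _ = 2 * √(2 * π * M) / (1 + t) * (√(t - s))⁻¹ := by
          rw [show π * (2 * M * (t - s)) = 2 * π * M * (t - s) by ring,
            sqrt_mul (by positivity)]
          nth_rewrite 1 [← mul_self_sqrt hts.le]
          field_simp

/-- Key intermediate bound for the nonlinear interaction term inside the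
characteristic cone. -/
theorem inner_cone_bound (a b c M : ℝ) (ha : a ≤ 0) (hM : 0 < M) :
    ∃ C > 0, ∀ x t : ℝ, 0 < t →
      ∫ s in (0 : ℝ)..t, ∫ y in (a * s)..(0 : ℝ),
          (t - s)⁻¹ * (1 + |y| + s)⁻¹ * (1 + |y - b * s|) ^ (-(1/2 : ℝ)) *
            Real.exp (-((x - y - c * (t - s)) ^ 2 / (2 * M * (t - s))))
        ≤ C * (1 + t) ^ (-(1/2 : ℝ)) := by
  refine ⟨16 * √(1 + |a| + |b|) + 4 * √(2 * π * M), by positivity, fun x t ht ↦ ?_⟩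
  have hint₁ : IntervalIntegrable (fun s : ℝ ↦ (1 + s) ^ (-(1 / 2 : ℝ))) volume 0 t := by
    refine ContinuousOn.intervalIntegrable (ContinuousOn.rpow_const (by fun_prop) fun s hs ↦ ?_)
    rw [Set.uIcc_of_le ht.le] at hs
    exact Or.inl (by linarith [hs.1])
  have hint₂ : IntervalIntegrable (fun s : ℝ ↦ (t - s) ^ (-(1 / 2 : ℝ))) volume 0 t := by
    simpa using (intervalIntegrable_rpow' (a := t) (b := 0)
      (r := -(1 / 2 : ℝ)) (by norm_num)).comp_sub_left t
  refine (intervalIntegral_le_of_nonneg_of_le ht.le (fun s hs ↦ ?_)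
    ((hint₁.const_mul (8 * √(1 + |a| + |b|) / t)).add
      (hint₂.const_mul (2 * √(2 * π * M) / (1 + t)))) fun s hs ↦ ?_).trans ?_
  · obtain ⟨hs₀, hs_lt⟩ := hs
    have hts : 0 < t - s := by linarith
    exact integral_nonneg (mul_nonpos_of_nonpos_of_nonneg ha hs₀.le) fun y _ ↦ by positivity
  · obtain ⟨hs₀, hs_lt⟩ := hs
    have hts : 0 < t - s := by linarith
    rcases le_total s (t / 2) with h | h
    · exact (inner_integral_le_of_le_half a b c M ha hM x hs₀ h).trans
        (le_add_of_nonneg_right (by positivity))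
    · exact (inner_integral_le_of_half_le a b c M ha hM x hs₀ h hs_lt).trans
        (le_add_of_nonneg_left (by positivity))
  · rw [integral_add (hint₁.const_mul _) (hint₂.const_mul _), intervalIntegral.integral_const_mul,
      intervalIntegral.integral_const_mul, integral_one_add_rpow_neg_half, integral_sub_rpow_neg_half,
      rpow_neg_half_eq_inv_sqrt (by positivity), add_mul]
    have hsq : √(1 + t) ^ 2 = 1 + t := sq_sqrt (by positivity)
    have hpos : 0 < √(1 + t) := sqrt_pos.2 (by positivity)
    have hle : √t ≤ √(1 + t) := sqrt_le_sqrt (by linarith)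
    have hone : 1 ≤ √(1 + t) := one_le_sqrt.2 (by linarith)
    have hfirst : (√(1 + t) - 1) / t ≤ (√(1 + t))⁻¹ := by
      rw [div_le_iff₀ ht, inv_mul_eq_div, le_div_iff₀ hpos]
      nlinarith
    have hsecond : √t / (1 + t) ≤ (√(1 + t))⁻¹ := by
      rw [div_le_iff₀ (by positivity), inv_mul_eq_div, le_div_iff₀ hpos]
      nlinarith
    calc 8 * √(1 + |a| + |b|) / t * (2 * (√(1 + t) - 1)) +
          2 * √(2 * π * M) / (1 + t) * (2 * √t)
        = 16 * √(1 + |a| + |b|) * ((√(1 + t) - 1) / t) +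
          4 * √(2 * π * M) * (√t / (1 + t)) := by ring
      _ ≤ _ := by gcongr
end

section
/- Assume additionally a₁ ≤ 0 ≤ a_m. For every M > 0 there exist M' > M and C > 0 such that, with θ, ψ₁, ψ₂ defined using the constant M', for all x ∈ ℝ and all t > 0: ∫₀^t ∫_{-∞}^{∞} (t−s)^{−1} Σ_{j=1}^m exp(−(x−y−a_j(t−s))²/(M(t−s))) · ψ₁(y,s)² dy ds ≤ C (θ + ψ₁ + ψ₂)(x,t). -/
open MeasureTheory Real intervalIntegral

lemma lintegral_gaussian_affine {c b : ℝ} (hc : 0 < c) (hb : b ≠ 0) (w : ℝ) :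
    ∫⁻ y : ℝ, ENNReal.ofReal (exp (-((w - b * y) ^ 2 / c))) =
      ENNReal.ofReal (√(π * c) / |b|) := by
  have heq : ∀ y : ℝ, exp (-((w - b * y) ^ 2 / c)) =
      (fun z : ℝ => exp (-(1 / c) * (z - w) ^ 2)) (b * y) := by
    intro y
    simp only
    congr 1
    ring
  simp_rw [heq]
  have hint : Integrable (fun z : ℝ => exp (-(1 / c) * (z - w) ^ 2)) :=
    (integrable_exp_neg_mul_sq (by positivity : 0 < 1 / c)).comp_sub_right w
  rw [← ofReal_integral_eq_lintegral_ofReal (hint.comp_mul_left' hb)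
    (Filter.Eventually.of_forall fun y => (exp_pos _).le)]
  congr 1
  rw [Measure.integral_comp_mul_left (fun z : ℝ => exp (-(1 / c) * (z - w) ^ 2)),
    integral_sub_right_eq_self (fun z : ℝ => exp (-(1 / c) * z ^ 2)), integral_gaussian,
    smul_eq_mul, abs_inv, div_div_eq_mul_div, div_one, div_eq_inv_mul]

lemma setLIntegral_rpow_neg {r q : ℝ} (hr : 0 ≤ r) (hq : q < 1) :
    ∫⁻ u in Set.Ioc 0 r, ENNReal.ofReal (u ^ (-q)) = ENNReal.ofReal (r ^ (1 - q) / (1 - q)) := by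
  have hq' : -1 < -q := by linarith
  have hi : IntervalIntegrable (fun u : ℝ => u ^ (-q)) volume 0 r :=
    intervalIntegral.intervalIntegrable_rpow' hq'
  rw [intervalIntegrable_iff_integrableOn_Ioc_of_le hr] at hi
  rw [← ofReal_integral_eq_lintegral_ofReal hi, ← intervalIntegral.integral_of_le hr,
    integral_rpow (Or.inl hq')]
  · rw [zero_rpow (by linarith), sub_zero, neg_add_eq_sub]
  · filter_upwards [ae_restrict_mem measurableSet_Ioc] with u hu
    exact rpow_nonneg hu.1.le _

lemma lintegral_abs_rpow_neg_half_le {r : ℝ} (hr : 0 ≤ r) :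
    ∫⁻ u : ℝ, ENNReal.ofReal (if |u| ≤ r then |u| ^ (-(1 / 2 : ℝ)) else 0) ≤
      ENNReal.ofReal (4 * √r) := by
  set g : ℝ → ENNReal := (Set.Ioc 0 r).indicator fun u => ENNReal.ofReal (u ^ (-(1 / 2 : ℝ)))
  have hg : Measurable g := Measurable.indicator (by fun_prop) measurableSet_Ioc
  have hgi : ∫⁻ u, g u = ENNReal.ofReal (2 * √r) := by
    rw [lintegral_indicator measurableSet_Ioc, setLIntegral_rpow_neg hr (by norm_num),
      sqrt_eq_rpow]
    congr 1
    norm_num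
    ring
  calc _ ≤ ∫⁻ u, (g u + g (-u)) := by
        refine lintegral_mono fun u => ?_
        by_cases h : |u| ≤ r
        · rw [if_pos h]
          rcases lt_trichotomy u 0 with h0 | h0 | h0
          · rw [abs_of_neg h0] at h ⊢
            refine le_add_left (le_of_eq ?_)
            exact (Set.indicator_of_mem (s := Set.Ioc 0 r) (a := -u) ⟨by linarith, h⟩
              fun u => ENNReal.ofReal (u ^ (-(1 / 2 : ℝ)))).symm
          · simp [h0, zero_rpow]
          · rw [abs_of_pos h0] at h ⊢
            refine le_add_right (le_of_eq ?_)
            exact (Set.indicator_of_mem (s := Set.Ioc 0 r) (a := u) ⟨h0, h⟩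
              fun u => ENNReal.ofReal (u ^ (-(1 / 2 : ℝ)))).symm
        · simp [h]
    _ = ENNReal.ofReal (4 * √r) := by
        rw [lintegral_add_left hg, (Measure.measurePreserving_neg volume).lintegral_comp hg, hgi,
          ← ENNReal.ofReal_add (by positivity) (by positivity)]
        congr 1
        ring

/-- Convolution of the Gaussian `exp (-(·)² / (κ τ))` with `(1 + |·|)^{-1/2}`. -/
lemma lintegral_gaussian_mul_rpow_le {κ τ : ℝ} (hκ : 0 < κ) (hτ : 0 < τ) (w v : ℝ) :
    ∫⁻ y : ℝ, ENNReal.ofReal (exp (-((w - y) ^ 2 / (κ * τ))) * (1 + |y - v|) ^ (-(1 / 2 : ℝ))) ≤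
      ENNReal.ofReal ((4 + √(π * κ)) * τ ^ (1 / 4 : ℝ)) := by
  have hs : 0 < √τ := sqrt_pos.2 hτ
  have hq : √√τ = τ ^ (1 / 4 : ℝ) := by
    rw [sqrt_eq_rpow, sqrt_eq_rpow, ← rpow_mul hτ.le]
    norm_num
  calc _ ≤ ∫⁻ y : ℝ, (ENNReal.ofReal (if |y - v| ≤ √τ then |y - v| ^ (-(1 / 2 : ℝ)) else 0) +
          ENNReal.ofReal (√τ ^ (-(1 / 2 : ℝ))) *
            ENNReal.ofReal (exp (-((w - 1 * y) ^ 2 / (κ * τ))))) := by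
        refine lintegral_mono_ae ?_
        filter_upwards [compl_mem_ae_iff.2 (measure_singleton v)] with y hy
        have hy' : 0 < |y - v| := abs_pos.2 (sub_ne_zero.2 hy)
        have hle : exp (-((w - y) ^ 2 / (κ * τ))) ≤ 1 := by
          rw [exp_le_one_iff]
          have : 0 ≤ (w - y) ^ 2 / (κ * τ) := by positivity
          linarith
        have hr : (1 + |y - v|) ^ (-(1 / 2 : ℝ)) ≤ |y - v| ^ (-(1 / 2 : ℝ)) :=
          rpow_le_rpow_of_nonpos hy' (by linarith) (by norm_num)
        rw [one_mul]
        split_ifs with h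
        · refine le_add_right (ENNReal.ofReal_le_ofReal ?_)
          calc _ ≤ 1 * |y - v| ^ (-(1 / 2 : ℝ)) := by gcongr
            _ = _ := one_mul _
        · rw [← ENNReal.ofReal_mul (by positivity)]
          refine le_add_left (ENNReal.ofReal_le_ofReal ?_)
          rw [mul_comm]
          exact mul_le_mul_of_nonneg_right
            (hr.trans (rpow_le_rpow_of_nonpos hs (not_le.1 h).le (by norm_num))) (exp_pos _).le
    _ ≤ _ := by
        rw [lintegral_add_right _ (by fun_prop), lintegral_const_mul _ (by fun_prop),
          lintegral_gaussian_affine (by positivity) one_ne_zero,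
          lintegral_sub_right_eq_self
            (fun u => ENNReal.ofReal (if |u| ≤ √τ then |u| ^ (-(1 / 2 : ℝ)) else 0)),
          ← ENNReal.ofReal_mul (by positivity)]
        refine (add_le_add_left (lintegral_abs_rpow_neg_half_le hs.le) _).trans ?_
        rw [← ENNReal.ofReal_add (by positivity) (by positivity)]
        refine ENNReal.ofReal_le_ofReal (le_of_eq ?_)
        have h1 : √τ ^ (-(1 / 2 : ℝ)) * √τ = τ ^ (1 / 4 : ℝ) := by
          rw [← hq, sqrt_eq_rpow (√τ)]
          nth_rewrite 2 [← rpow_one (√τ)]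
          rw [← rpow_add hs]
          norm_num
        rw [abs_one, div_one, ← mul_assoc, sqrt_mul (by positivity), hq]
        linear_combination √(π * κ) * h1

lemma setLIntegral_weight_le {t : ℝ} (ht : 0 < t) :
    ∫⁻ s in Set.Ioo 0 t, ENNReal.ofReal ((1 + s)⁻¹ * (t - s) ^ (-(3 / 4 : ℝ))) ≤
      ENNReal.ofReal (16 * (1 + t) ^ (-(1 / 2 : ℝ))) := by
  have hI : ∫⁻ s in Set.Ioo 0 t, ENNReal.ofReal (s ^ (-(3 / 4 : ℝ))) =
      ENNReal.ofReal (4 * t ^ (1 / 4 : ℝ)) := by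
    rw [setLIntegral_congr Ioo_ae_eq_Ioc, setLIntegral_rpow_neg ht.le (by norm_num)]
    congr 1
    norm_num
    ring
  have hJ : ∫⁻ s in Set.Ioo 0 t, ENNReal.ofReal ((t - s) ^ (-(3 / 4 : ℝ))) =
      ENNReal.ofReal (4 * t ^ (1 / 4 : ℝ)) := by
    rw [← hI, ← lintegral_indicator measurableSet_Ioo, ← lintegral_indicator measurableSet_Ioo,
      ← lintegral_sub_left_eq_self _ t]
    refine lintegral_congr fun s => ?_
    by_cases h : s ∈ Set.Ioo 0 t
    · rw [Set.indicator_of_mem h, Set.indicator_of_mem (by constructor <;> linarith [h.1, h.2])]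
      simp
    · rw [Set.indicator_of_notMem h, Set.indicator_of_notMem]
      intro h'
      exact h ⟨by linarith [h'.2], by linarith [h'.1]⟩
  set A := (1 + t) ^ (-(3 / 4 : ℝ)) with hA
  calc _ ≤ ∫⁻ s in Set.Ioo 0 t, (ENNReal.ofReal (2 * A) * ENNReal.ofReal ((t - s) ^ (-(3 / 4 : ℝ))) +
          ENNReal.ofReal (2 * A) * ENNReal.ofReal (s ^ (-(3 / 4 : ℝ)))) := by
        refine setLIntegral_mono' measurableSet_Ioo fun s hs => ?_
        obtain ⟨h0, h1⟩ := hs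
        have h2 : 0 < t - s := by linarith
        have h34 : ∀ z : ℝ, (1 + t) / 2 ≤ z → z ^ (-(3 / 4 : ℝ)) ≤ 2 * A := by
          intro z hz
          calc z ^ (-(3 / 4 : ℝ)) ≤ ((1 + t) / 2) ^ (-(3 / 4 : ℝ)) :=
                rpow_le_rpow_of_nonpos (by positivity) hz (by norm_num)
            _ = 2 ^ (3 / 4 : ℝ) * A := by
                rw [div_rpow (by positivity) (by norm_num), rpow_neg (by norm_num : (0:ℝ) ≤ 2)]
                field_simp
                rfl
            _ ≤ 2 ^ (1 : ℝ) * A := by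
                gcongr
                · norm_num
                · norm_num
            _ = _ := by rw [rpow_one]
        have h3 : (1 + s)⁻¹ ≤ (1 + s) ^ (-(3 / 4 : ℝ)) := by
          rw [← rpow_neg_one]
          exact rpow_le_rpow_of_exponent_le (by linarith) (by norm_num)
        have h4 : (1 + s) ^ (-(3 / 4 : ℝ)) ≤ s ^ (-(3 / 4 : ℝ)) :=
          rpow_le_rpow_of_nonpos h0 (by linarith) (by norm_num)
        have h5 : 0 ≤ (t - s) ^ (-(3 / 4 : ℝ)) := by positivity
        have hA0 : 0 ≤ A := by positivity
        rw [← ENNReal.ofReal_mul (by positivity), ← ENNReal.ofReal_mul (by positivity)]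
        rcases le_total ((1 + t) / 2) (1 + s) with h | h
        · refine le_add_right (ENNReal.ofReal_le_ofReal ?_)
          gcongr
          exact h3.trans (h34 _ h)
        · refine le_add_left (ENNReal.ofReal_le_ofReal ?_)
          rw [mul_comm]
          gcongr
          · by_cases h' : (1 + t) / 2 ≤ t - s
            · exact h34 _ h'
            · linarith
          · exact h3.trans h4
    _ ≤ _ := by
        rw [lintegral_add_right _ (by fun_prop), lintegral_const_mul _ (by fun_prop),
          lintegral_const_mul _ (by fun_prop), hI, hJ, ← ENNReal.ofReal_mul (by positivity),
          ← ENNReal.ofReal_add (by positivity) (by positivity)]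
        refine ENNReal.ofReal_le_ofReal ?_
        have h1 : t ^ (1 / 4 : ℝ) ≤ (1 + t) ^ (1 / 4 : ℝ) := by gcongr; linarith
        have h2 : A * (1 + t) ^ (1 / 4 : ℝ) = (1 + t) ^ (-(1 / 2 : ℝ)) := by
          rw [hA, ← rpow_add (by positivity)]
          norm_num
        have hA0 : 0 ≤ A := by positivity
        rw [← h2]
        nlinarith [mul_le_mul_of_nonneg_left h1 hA0]

lemma setLIntegral_slab_eq (t : ℝ) {f : ℝ × ℝ → ENNReal} (hf : Measurable f) :
    ∫⁻ p in Set.Ioo 0 t ×ˢ Set.univ, f p = ∫⁻ s in Set.Ioo 0 t, ∫⁻ y, f (s, y) := by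
  rw [Measure.volume_eq_prod, ← Measure.prod_restrict, Measure.restrict_univ,
    lintegral_prod _ hf.aemeasurable]

/-- The reduced Green kernel bound times `(1 + s)⁻¹ (1 + |y - β s|)^{-q}`, at `p = (s, y)`. -/
noncomputable def interaction (κ α β q x t : ℝ) (p : ℝ × ℝ) : ℝ :=
  (1 + p.1)⁻¹ * (t - p.1)⁻¹ * exp (-((x - p.2 - α * (t - p.1)) ^ 2 / (κ * (t - p.1)))) *
    (1 + |p.2 - β * p.1|) ^ (-q)

lemma measurable_interaction (κ α β q x t : ℝ) : Measurable (interaction κ α β q x t) := by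
  unfold interaction
  fun_prop

lemma interaction_nonneg (κ α β q x : ℝ) {t : ℝ} {p : ℝ × ℝ} (h0 : 0 < p.1) (h1 : p.1 < t) :
    0 ≤ interaction κ α β q x t p := by
  have : 0 < t - p.1 := sub_pos.2 h1
  unfold interaction
  positivity

lemma lintegral_interaction_half_le {κ t : ℝ} (hκ : 0 < κ) (ht : 0 < t) (α β x : ℝ) :
    ∫⁻ p in Set.Ioo 0 t ×ˢ Set.univ, ENNReal.ofReal (interaction κ α β (1 / 2) x t p) ≤
      ENNReal.ofReal (16 * (4 + √(π * κ)) * (1 + t) ^ (-(1 / 2 : ℝ))) := by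
  rw [setLIntegral_slab_eq t (measurable_interaction κ α β _ x t).ennreal_ofReal]
  calc _ ≤ ∫⁻ s in Set.Ioo 0 t, ENNReal.ofReal (4 + √(π * κ)) *
          ENNReal.ofReal ((1 + s)⁻¹ * (t - s) ^ (-(3 / 4 : ℝ))) := by
        refine setLIntegral_mono' measurableSet_Ioo fun s hs => ?_
        obtain ⟨h0, h1⟩ := hs
        have h2 : 0 < t - s := by linarith
        have heq : ∀ y, ENNReal.ofReal (interaction κ α β (1 / 2) x t (s, y)) =
            ENNReal.ofReal ((1 + s)⁻¹ * (t - s)⁻¹) *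
              ENNReal.ofReal (exp (-(((x - α * (t - s)) - y) ^ 2 / (κ * (t - s)))) *
                (1 + |y - β * s|) ^ (-(1 / 2 : ℝ))) := by
          intro y
          rw [← ENNReal.ofReal_mul (by positivity), interaction, sub_right_comm, mul_assoc]
        simp_rw [heq]
        rw [lintegral_const_mul _ (by fun_prop)]
        refine (mul_le_mul_right (lintegral_gaussian_mul_rpow_le hκ h2 _ _) _).trans ?_
        rw [← ENNReal.ofReal_mul (by positivity), ← ENNReal.ofReal_mul (by positivity)]
        refine ENNReal.ofReal_le_ofReal (le_of_eq ?_)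
        have : (t - s)⁻¹ * (t - s) ^ (1 / 4 : ℝ) = (t - s) ^ (-(3 / 4 : ℝ)) := by
          rw [← rpow_neg_one, ← rpow_add h2]
          norm_num
        rw [← this]
        ring
    _ ≤ _ := by
        rw [lintegral_const_mul _ (by fun_prop)]
        refine (mul_le_mul_right (setLIntegral_weight_le ht) _).trans ?_
        rw [← ENNReal.ofReal_mul (by positivity)]
        refine ENNReal.ofReal_le_ofReal (le_of_eq ?_)
        ring

lemma lintegral_truncated_inv_le {μ : ℝ} (hμ : 0 ≤ μ) :
    ∫⁻ u : ℝ, ENNReal.ofReal (if |u| ≤ μ / 4 then (1 + |u|)⁻¹ else 0) ≤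
      ENNReal.ofReal (4 * μ * (1 + μ) ^ (-(1 / 2 : ℝ))) := by
  have hpow : (1 + μ) ^ (-(1 / 2 : ℝ)) = (√(1 + μ))⁻¹ := by
    rw [rpow_neg (by positivity), sqrt_eq_rpow]
  have hs : 0 < √(1 + μ) := by positivity
  rw [hpow, ← div_eq_mul_inv]
  rcases le_total μ 1 with h | h
  · calc _ ≤ ∫⁻ u : ℝ, (Set.Icc (-(μ / 4)) (μ / 4)).indicator 1 u := by
          refine lintegral_mono fun u => ?_
          split_ifs with hu
          · rw [Set.indicator_of_mem (Set.mem_Icc.2 (abs_le.1 hu))]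
            refine (ENNReal.ofReal_le_ofReal ?_).trans ENNReal.ofReal_one.le
            exact inv_le_one_of_one_le₀ (by linarith [abs_nonneg u])
          · simp
      _ = ENNReal.ofReal (μ / 2) := by
          rw [lintegral_indicator_one measurableSet_Icc, Real.volume_Icc]
          congr 1
          ring
      _ ≤ _ := by
          refine ENNReal.ofReal_le_ofReal ?_
          rw [le_div_iff₀ hs]
          have : √(1 + μ) ≤ 2 := sqrt_le_iff.2 ⟨by norm_num, by linarith⟩
          nlinarith
  · calc _ ≤ ∫⁻ u : ℝ, ENNReal.ofReal (if |u| ≤ μ / 4 then |u| ^ (-(1 / 2 : ℝ)) else 0) := by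
          refine lintegral_mono_ae ?_
          filter_upwards [compl_mem_ae_iff.2 (measure_singleton 0)] with u hu
          have hu' : 0 < |u| := abs_pos.2 hu
          refine ENNReal.ofReal_le_ofReal ?_
          split_ifs with hle
          · calc (1 + |u|)⁻¹ ≤ (1 + |u|) ^ (-(1 / 2 : ℝ)) := by
                  rw [← rpow_neg_one]
                  exact rpow_le_rpow_of_exponent_le (by linarith) (by norm_num)
              _ ≤ _ := rpow_le_rpow_of_nonpos hu' (by linarith) (by norm_num)
          · exact le_rfl
      _ ≤ ENNReal.ofReal (4 * √(μ / 4)) := lintegral_abs_rpow_neg_half_le (by positivity)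
      _ ≤ _ := by
          refine ENNReal.ofReal_le_ofReal ?_
          rw [le_div_iff₀ hs, mul_assoc, ← sqrt_mul (by positivity)]
          have : √(μ / 4 * (1 + μ)) ≤ μ := sqrt_le_iff.2 ⟨hμ, by nlinarith⟩
          linarith

/-- The part of the interaction near the line `y = β s`, with the Gaussian frozen at time `t`. -/
noncomputable def crossing (M α β μ x t : ℝ) (p : ℝ × ℝ) : ℝ :=
  exp (-((x - p.2 - α * (t - p.1)) ^ 2 / (M * t))) *
    if |p.2 - β * p.1| ≤ μ / 4 then (1 + |p.2 - β * p.1|)⁻¹ else 0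

lemma measurable_crossing (M α β μ x t : ℝ) : Measurable (crossing M α β μ x t) := by
  unfold crossing
  refine Measurable.mul (by fun_prop) (Measurable.ite ?_ (by fun_prop) measurable_const)
  exact measurableSet_le (by fun_prop) (by fun_prop)

lemma lintegral_crossing_le {M t μ α β : ℝ} (hM : 0 < M) (ht : 0 < t) (hμ : 0 ≤ μ)
    (hαβ : β - α ≠ 0) (x : ℝ) :
    ∫⁻ p in Set.Ioo 0 t ×ˢ Set.univ, ENNReal.ofReal (crossing M α β μ x t p) ≤
      ENNReal.ofReal (√(π * (M * t)) / |β - α| * (4 * μ * (1 + μ) ^ (-(1 / 2 : ℝ)))) := by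
  set h : ℝ → ENNReal := fun u => ENNReal.ofReal (if |u| ≤ μ / 4 then (1 + |u|)⁻¹ else 0)
  have hh : Measurable h :=
    (Measurable.ite (measurableSet_le (by fun_prop) (by fun_prop)) (by fun_prop)
      measurable_const).ennreal_ofReal
  set g : ℝ → ℝ → ENNReal := fun s u =>
    ENNReal.ofReal (exp (-((x - α * t - u - (β - α) * s) ^ 2 / (M * t)))) * h u
  have hg : Measurable (Function.uncurry g) := by
    refine Measurable.mul (by fun_prop) (hh.comp measurable_snd)
  rw [setLIntegral_slab_eq t (measurable_crossing M α β μ x t).ennreal_ofReal]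
  calc _ = ∫⁻ s in Set.Ioo 0 t, ∫⁻ u, g s u := by
        refine lintegral_congr fun s => ?_
        rw [← lintegral_sub_right_eq_self (fun u => g s u) (β * s)]
        refine lintegral_congr fun y => ?_
        simp only [g, h, crossing]
        rw [ENNReal.ofReal_mul (exp_pos _).le]
        congr 5
        ring
    _ ≤ ∫⁻ s, ∫⁻ u, g s u := setLIntegral_le_lintegral _ _
    _ = ∫⁻ u, ∫⁻ s, g s u := lintegral_lintegral_swap hg.aemeasurable
    _ = ∫⁻ u, ENNReal.ofReal (√(π * (M * t)) / |β - α|) * h u := by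
        refine lintegral_congr fun u => ?_
        simp only [g]
        rw [lintegral_mul_const _ (by fun_prop), lintegral_gaussian_affine (by positivity) hαβ]
    _ ≤ _ := by
        rw [lintegral_const_mul _ hh, ENNReal.ofReal_mul (by positivity)]
        gcongr
        exact lintegral_truncated_inv_le hμ

lemma interaction_one_le_of_far_kernel {M α β μ x t : ℝ} {p : ℝ × ℝ} (hM : 0 < M) (hμ : 0 ≤ μ)
    (h0 : 0 < p.1) (h1 : p.1 < t) (hz : μ ≤ 4 * |x - p.2 - α * (t - p.1)|) :
    interaction M α β 1 x t p ≤
      exp (-(μ ^ 2 / (32 * M * t))) * interaction (2 * M) α β (1 / 2) x t p := by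
  have hτ : 0 < t - p.1 := sub_pos.2 h1
  have ht : 0 < t := h0.trans h1
  unfold interaction
  set z := x - p.2 - α * (t - p.1)
  have hz2 : μ ^ 2 ≤ 16 * z ^ 2 := by
    have := mul_self_le_mul_self hμ hz
    nlinarith [sq_abs z]
  have hE : exp (-(z ^ 2 / (M * (t - p.1)))) ≤
      exp (-(μ ^ 2 / (32 * M * t))) * exp (-(z ^ 2 / (2 * M * (t - p.1)))) := by
    rw [← exp_add, exp_le_exp]
    have e1 : z ^ 2 / (M * (t - p.1)) =
        16 * z ^ 2 / (32 * M * (t - p.1)) + z ^ 2 / (2 * M * (t - p.1)) := by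
      field_simp
      ring
    have e2 : μ ^ 2 / (32 * M * t) ≤ 16 * z ^ 2 / (32 * M * (t - p.1)) := by
      gcongr
      linarith
    linarith
  have hpow : (1 + |p.2 - β * p.1|) ^ (-1 : ℝ) ≤ (1 + |p.2 - β * p.1|) ^ (-(1 / 2 : ℝ)) :=
    rpow_le_rpow_of_exponent_le (by linarith [abs_nonneg (p.2 - β * p.1)]) (by norm_num)
  calc _ ≤ (1 + p.1)⁻¹ * (t - p.1)⁻¹ *
          (exp (-(μ ^ 2 / (32 * M * t))) * exp (-(z ^ 2 / (2 * M * (t - p.1))))) *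
          (1 + |p.2 - β * p.1|) ^ (-(1 / 2 : ℝ)) := by gcongr
    _ = _ := by ring

lemma interaction_one_le_of_far_source {M α β μ x t : ℝ} {p : ℝ × ℝ} (hM : 0 < M) (hμ : 0 ≤ μ)
    (h0 : 0 < p.1) (h1 : p.1 < t) (hu : μ ≤ 4 * |p.2 - β * p.1|) :
    interaction M α β 1 x t p ≤
      2 * (1 + μ) ^ (-(1 / 2 : ℝ)) * interaction (2 * M) α β (1 / 2) x t p := by
  have hτ : 0 < t - p.1 := sub_pos.2 h1
  unfold interaction
  set z := x - p.2 - α * (t - p.1)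
  set u := p.2 - β * p.1
  have hE : exp (-(z ^ 2 / (M * (t - p.1)))) ≤ exp (-(z ^ 2 / (2 * M * (t - p.1)))) := by
    rw [exp_le_exp, neg_le_neg_iff]
    gcongr
    linarith
  have hpow : (1 + |u|) ^ (-1 : ℝ) ≤
      2 * (1 + μ) ^ (-(1 / 2 : ℝ)) * (1 + |u|) ^ (-(1 / 2 : ℝ)) := by
    have hsplit : (1 + |u|) ^ (-1 : ℝ) =
        (1 + |u|) ^ (-(1 / 2 : ℝ)) * (1 + |u|) ^ (-(1 / 2 : ℝ)) := by
      rw [← rpow_add (by positivity)]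
      norm_num
    have h4 : (4 : ℝ) ^ (1 / 2 : ℝ) = 2 := by
      rw [← sqrt_eq_rpow, show (4 : ℝ) = 2 ^ 2 by norm_num, sqrt_sq (by norm_num)]
    rw [hsplit]
    gcongr
    calc (1 + |u|) ^ (-(1 / 2 : ℝ)) ≤ ((1 + μ) / 4) ^ (-(1 / 2 : ℝ)) :=
          rpow_le_rpow_of_nonpos (by positivity) (by linarith) (by norm_num)
      _ = _ := by
          rw [div_rpow (by positivity) (by norm_num), rpow_neg (by norm_num : (0 : ℝ) ≤ 4), h4,
            div_inv_eq_mul, mul_comm]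
  calc _ ≤ (1 + p.1)⁻¹ * (t - p.1)⁻¹ * exp (-(z ^ 2 / (2 * M * (t - p.1)))) *
          (2 * (1 + μ) ^ (-(1 / 2 : ℝ)) * (1 + |u|) ^ (-(1 / 2 : ℝ))) := by gcongr
    _ = _ := by ring

lemma interaction_one_le_crossing {M α β μ x t : ℝ} {p : ℝ × ℝ} (hM : 0 < M)
    (h0 : 0 < p.1) (h1 : p.1 < t) (hα : μ ≤ |x - α * t|) (hβ : μ ≤ |x - β * t|)
    (hz : 4 * |x - p.2 - α * (t - p.1)| < μ) (hu : 4 * |p.2 - β * p.1| < μ) :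
    interaction M α β 1 x t p ≤ 4 * |β - α| / ((1 + t) * μ) * crossing M α β μ x t p := by
  have hτ : 0 < t - p.1 := sub_pos.2 h1
  have ht : 0 < t := h0.trans h1
  unfold interaction crossing
  rw [if_pos (by linarith)]
  have ex1 : x - α * t = (x - p.2 - α * (t - p.1)) + (p.2 - β * p.1) + (β - α) * p.1 := by ring
  have ex2 : x - β * t =
      (x - p.2 - α * (t - p.1)) + (p.2 - β * p.1) - (β - α) * (t - p.1) := by ring
  set z := x - p.2 - α * (t - p.1)
  set u := p.2 - β * p.1
  have hμ : 0 < μ := by linarith [abs_nonneg z]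
  have hs : μ ≤ 2 * (|β - α| * p.1) := by
    have h := abs_add_three z u ((β - α) * p.1)
    rw [← ex1, abs_mul, abs_of_pos h0] at h
    linarith
  have hs' : μ ≤ 2 * (|β - α| * (t - p.1)) := by
    have h := (abs_sub (z + u) ((β - α) * (t - p.1))).trans (add_le_add_left (abs_add_le z u) _)
    rw [← ex2, abs_mul, abs_of_pos hτ] at h
    linarith
  have hw : (1 + p.1)⁻¹ * (t - p.1)⁻¹ ≤ 4 * |β - α| / ((1 + t) * μ) := by
    have e : (1 + p.1)⁻¹ * (t - p.1)⁻¹ = (1 + t)⁻¹ * ((1 + p.1)⁻¹ + (t - p.1)⁻¹) := by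
      field_simp
      ring
    have e1 : (1 + p.1)⁻¹ ≤ 2 * |β - α| / μ := by
      rw [inv_le_comm₀ (by positivity) (by nlinarith [div_pos (hμ.trans_le hs) hμ, show
        2 * |β - α| / μ * p.1 = 2 * (|β - α| * p.1) / μ by ring]), inv_div, div_le_iff₀
        (by nlinarith)]
      nlinarith [abs_nonneg (β - α)]
    have e2 : (t - p.1)⁻¹ ≤ 2 * |β - α| / μ := by
      rw [le_div_iff₀ hμ, inv_mul_le_iff₀ hτ]
      linarith
    calc _ ≤ (1 + t)⁻¹ * (2 * |β - α| / μ + 2 * |β - α| / μ) := by rw [e]; gcongr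
      _ = _ := by
        field_simp
        ring
  have hE : exp (-(z ^ 2 / (M * (t - p.1)))) ≤ exp (-(z ^ 2 / (M * t))) := by
    rw [exp_le_exp, neg_le_neg_iff]
    gcongr
    linarith
  rw [rpow_neg_one, mul_assoc]
  gcongr

lemma lintegral_le_of_far_kernel {M t : ℝ} (hM : 0 < M) (ht : 0 < t) (α β μ x : ℝ) :
    ∫⁻ p in Set.Ioo 0 t ×ˢ Set.univ, ENNReal.ofReal
        (exp (-(μ ^ 2 / (32 * M * t))) * interaction (2 * M) α β (1 / 2) x t p) ≤
      ENNReal.ofReal (16 * (4 + √(π * (2 * M))) *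
        ((1 + t) ^ (-(1 / 2 : ℝ)) * exp (-(μ ^ 2 / (32 * M * t))))) := by
  simp_rw [ENNReal.ofReal_mul (exp_pos (-(μ ^ 2 / (32 * M * t)))).le]
  rw [lintegral_const_mul _ (measurable_interaction _ _ _ _ _ _).ennreal_ofReal]
  refine (mul_le_mul_right
    (lintegral_interaction_half_le (by positivity : 0 < 2 * M) ht α β x) _).trans ?_
  rw [← ENNReal.ofReal_mul (exp_pos _).le]
  exact ENNReal.ofReal_le_ofReal (le_of_eq (by ring))

/-- Bound for the interaction of one kernel with one source at distance at least `μ` from both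
characteristics. -/
lemma lintegral_interaction_one_le {M α β μ x t : ℝ} (hM : 0 < M) (ht : 0 < t) (hμ : 0 ≤ μ)
    (hα : μ ≤ |x - α * t|) (hβ : μ ≤ |x - β * t|) :
    ∫⁻ p in Set.Ioo 0 t ×ˢ Set.univ, ENNReal.ofReal (interaction M α β 1 x t p) ≤
      ENNReal.ofReal (48 * (4 + √(π * (2 * M))) *
        ((1 + t) ^ (-(1 / 2 : ℝ)) * exp (-(μ ^ 2 / (32 * M * t))) +
          (1 + t) ^ (-(1 / 2 : ℝ)) * (1 + μ) ^ (-(1 / 2 : ℝ)))) := by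
  set S := 4 + √(π * (2 * M))
  set T := (1 + t) ^ (-(1 / 2 : ℝ)) with hT
  set L := (1 + μ) ^ (-(1 / 2 : ℝ))
  set e := exp (-(μ ^ 2 / (32 * M * t)))
  set A : ℝ × ℝ → ℝ := interaction (2 * M) α β (1 / 2) x t
  set c := 4 * |β - α| / ((1 + t) * μ) with hc
  have hAm : Measurable A := measurable_interaction _ _ _ _ _ _
  have hcr : ∫⁻ p in Set.Ioo 0 t ×ˢ Set.univ, ENNReal.ofReal (c * crossing M α β μ x t p) ≤
      ENNReal.ofReal (16 * S * (T * L)) := by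
    have hc0 : 0 ≤ c := by positivity
    by_cases hz : c = 0
    · simp [hz]
    have hμ0 : μ ≠ 0 := by
      rintro rfl
      simp [hc] at hz
    have hαβ : β - α ≠ 0 := by
      intro h
      simp [hc, h] at hz
    simp_rw [ENNReal.ofReal_mul hc0]
    rw [lintegral_const_mul _ (measurable_crossing _ _ _ _ _ _).ennreal_ofReal]
    refine (mul_le_mul_right (lintegral_crossing_le hM ht hμ hαβ x) _).trans ?_
    rw [← ENNReal.ofReal_mul hc0]
    refine ENNReal.ofReal_le_ofReal ?_
    have e1 : c * (√(π * (M * t)) / |β - α| * (4 * μ * L)) =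
        16 * (√(π * M) * (√t * (1 + t)⁻¹)) * L := by
      have := abs_pos.2 hαβ
      rw [← mul_assoc π, sqrt_mul (by positivity), hc]
      field_simp
      ring
    have e2 : √t * (1 + t)⁻¹ ≤ T := by
      have h : √t ≤ (1 + t) ^ (1 / 2 : ℝ) := by
        rw [← sqrt_eq_rpow]
        exact sqrt_le_sqrt (by linarith)
      calc _ ≤ (1 + t) ^ (1 / 2 : ℝ) * (1 + t)⁻¹ := by gcongr
        _ = T := by
          rw [← rpow_neg_one, ← rpow_add (by positivity), hT]
          norm_num
    have e3 : √(π * M) ≤ S := by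
      have : √(π * M) ≤ √(π * (2 * M)) := by
        refine sqrt_le_sqrt ?_
        gcongr
        linarith
      linarith
    rw [e1]
    calc _ ≤ 16 * (S * T) * L := by gcongr
      _ = _ := by ring
  have hnear : ∫⁻ p in Set.Ioo 0 t ×ˢ Set.univ, ENNReal.ofReal (2 * L * A p) ≤
      ENNReal.ofReal (32 * S * (T * L)) := by
    have hL : 0 ≤ 2 * L := by positivity
    simp_rw [ENNReal.ofReal_mul hL]
    rw [lintegral_const_mul _ hAm.ennreal_ofReal]
    refine (mul_le_mul_right
      (lintegral_interaction_half_le (by positivity : 0 < 2 * M) ht α β x) _).trans ?_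
    rw [← ENNReal.ofReal_mul hL]
    exact ENNReal.ofReal_le_ofReal (le_of_eq (by ring))
  have hcm : Measurable fun p => ENNReal.ofReal (c * crossing M α β μ x t p) :=
    ((measurable_crossing _ _ _ _ _ _).const_mul _).ennreal_ofReal
  calc _ ≤ ∫⁻ p in Set.Ioo 0 t ×ˢ Set.univ, (ENNReal.ofReal (e * A p) +
          (ENNReal.ofReal (2 * L * A p) + ENNReal.ofReal (c * crossing M α β μ x t p))) := by
        refine setLIntegral_mono' (measurableSet_Ioo.prod MeasurableSet.univ) fun p hp => ?_
        obtain ⟨⟨h0, h1⟩, -⟩ := hp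
        by_cases hz : μ ≤ 4 * |x - p.2 - α * (t - p.1)|
        · exact le_add_right (ENNReal.ofReal_le_ofReal
            (interaction_one_le_of_far_kernel hM hμ h0 h1 hz))
        refine le_add_left ?_
        by_cases hu : μ ≤ 4 * |p.2 - β * p.1|
        · exact le_add_right (ENNReal.ofReal_le_ofReal
            (interaction_one_le_of_far_source hM hμ h0 h1 hu))
        · exact le_add_left (ENNReal.ofReal_le_ofReal (interaction_one_le_crossing hM h0 h1 hα hβ
            (not_le.1 hz) (not_le.1 hu)))
    _ ≤ ENNReal.ofReal (16 * S * (T * e)) +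
          (ENNReal.ofReal (32 * S * (T * L)) + ENNReal.ofReal (16 * S * (T * L))) := by
        rw [lintegral_add_right _ (by fun_prop), lintegral_add_right _ hcm]
        gcongr
        exact lintegral_le_of_far_kernel hM ht α β μ x
    _ ≤ _ := by
        rw [← ENNReal.ofReal_add (by positivity) (by positivity),
          ← ENNReal.ofReal_add (by positivity) (by positivity)]
        refine ENNReal.ofReal_le_ofReal ?_
        have : 0 ≤ S * (T * e) := by positivity
        linarith

lemma psi1_nonneg (m : ℕ) (a : Fin m → ℝ) (a1 am x : ℝ) {t : ℝ} (ht : 0 ≤ t) :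
    0 ≤ psi1 m a a1 am x t := by
  unfold psi1 chi
  split_ifs
  · positivity
  · simp

lemma psi1_sq_le (m : ℕ) (a : Fin m → ℝ) (a1 am y : ℝ) {s : ℝ} (hs : 0 < s) :
    psi1 m a a1 am y s ^ 2 ≤ m * ∑ k, (1 + s)⁻¹ * (1 + |y - a k * s|) ^ (-1 : ℝ) := by
  have hnn : 0 ≤ (m : ℝ) * ∑ k, (1 + s)⁻¹ * (1 + |y - a k * s|) ^ (-1 : ℝ) := by positivity
  unfold psi1 chi
  split_ifs
  · rw [one_mul]
    refine (sq_sum_le_card_mul_sum_sq).trans ?_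
    rw [Finset.card_univ, Fintype.card_fin]
    gcongr with k
    rw [mul_pow, ← rpow_natCast, ← rpow_natCast, ← rpow_mul (by positivity),
      ← rpow_mul (by positivity), ← rpow_neg_one (1 + s),
      show -(1 / 2 : ℝ) * (2 : ℕ) = -1 by norm_num]
    refine mul_le_mul_of_nonneg_right ?_ (by positivity)
    exact rpow_le_rpow_of_nonpos (by positivity) (by linarith [abs_nonneg y]) (by norm_num)
  · simpa using hnn

lemma integral_integral_le_of_lintegral_slab {t K : ℝ} (ht : 0 ≤ t) (hK : 0 ≤ K)
    {F : ℝ → ℝ → ℝ} {Φ : ℝ × ℝ → ENNReal} (hΦ : Measurable Φ)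
    (hF : ∀ s ∈ Set.Ioo 0 t, ∀ y, ‖F s y‖ₑ ≤ Φ (s, y))
    (hΦK : ∫⁻ p in Set.Ioo 0 t ×ˢ Set.univ, Φ p ≤ ENNReal.ofReal K) :
    ∫ s in (0 : ℝ)..t, ∫ y, F s y ≤ K := by
  rw [intervalIntegral.integral_of_le ht, integral_Ioc_eq_integral_Ioo]
  have h : ‖∫ s in Set.Ioo 0 t, ∫ y, F s y‖ₑ ≤ ENNReal.ofReal K := by
    calc _ ≤ ∫⁻ s in Set.Ioo 0 t, ‖∫ y, F s y‖ₑ := enorm_integral_le_lintegral_enorm _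
      _ ≤ ∫⁻ s in Set.Ioo 0 t, ∫⁻ y, Φ (s, y) :=
        setLIntegral_mono' measurableSet_Ioo fun s hs =>
          (enorm_integral_le_lintegral_enorm _).trans (lintegral_mono (hF s hs))
      _ ≤ _ := by rwa [← setLIntegral_slab_eq t hΦ]
  rw [← ofReal_norm, ENNReal.ofReal_le_ofReal_iff hK] at h
  exact (le_abs_self _).trans h

lemma integral_integral_le_of_sum {m : ℕ} {t K : ℝ} (ht : 0 ≤ t) (hK : 0 ≤ K)
    {F : ℝ → ℝ → ℝ} {Φ : Fin m → Fin m → ℝ × ℝ → ℝ} (hΦ : ∀ j k, Measurable (Φ j k))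
    (hF0 : ∀ s ∈ Set.Ioo 0 t, ∀ y, 0 ≤ F s y)
    (hΦ0 : ∀ s ∈ Set.Ioo 0 t, ∀ y j k, 0 ≤ Φ j k (s, y))
    (hF : ∀ s ∈ Set.Ioo 0 t, ∀ y, F s y ≤ m * ∑ j, ∑ k, Φ j k (s, y))
    (hΦK : ∀ j k, ∫⁻ p in Set.Ioo 0 t ×ˢ Set.univ, ENNReal.ofReal (Φ j k p) ≤ ENNReal.ofReal K) :
    ∫ s in (0 : ℝ)..t, ∫ y, F s y ≤ (m : ℝ) ^ 3 * K := by
  have hm : ∀ j k, Measurable fun p => ENNReal.ofReal (Φ j k p) :=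
    fun j k => (hΦ j k).ennreal_ofReal
  refine integral_integral_le_of_lintegral_slab ht (by positivity)
    (Φ := fun p => ENNReal.ofReal m * ∑ j, ∑ k, ENNReal.ofReal (Φ j k p))
    (by fun_prop) (fun s hs y => ?_) ?_
  · rw [enorm_of_nonneg (hF0 s hs y)]
    refine (ENNReal.ofReal_le_ofReal (hF s hs y)).trans (le_of_eq ?_)
    rw [ENNReal.ofReal_mul (by positivity), ENNReal.ofReal_sum_of_nonneg
      fun j _ => Finset.sum_nonneg fun k _ => hΦ0 s hs y j k]
    congr 1
    exact Finset.sum_congr rfl fun j _ =>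
      ENNReal.ofReal_sum_of_nonneg fun k _ => hΦ0 s hs y j k
  · rw [lintegral_const_mul _ (by fun_prop), lintegral_finsetSum _ (by fun_prop)]
    calc _ = ENNReal.ofReal m * ∑ j, ∑ k,
          ∫⁻ p in Set.Ioo 0 t ×ˢ Set.univ, ENNReal.ofReal (Φ j k p) := by
          congr 1
          exact Finset.sum_congr rfl fun j _ => lintegral_finsetSum _ fun k _ => hm j k
      _ ≤ ENNReal.ofReal m * ∑ _j : Fin m, ∑ _k : Fin m, ENNReal.ofReal K := by
          gcongr with j _ k _
          exact hΦK j k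
      _ = _ := by
          simp only [Finset.sum_const, Finset.card_univ, Fintype.card_fin, nsmul_eq_mul]
          rw [ENNReal.ofReal_mul (by positivity), ENNReal.ofReal_pow (by positivity),
            ENNReal.ofReal_natCast]
          ring

lemma integrand_le_sum_interaction (m : ℕ) (a : Fin m → ℝ) (a1 am M x y : ℝ) {s t : ℝ}
    (h0 : 0 < s) (h1 : s < t) :
    (t - s)⁻¹ * (∑ j, exp (-((x - y - a j * (t - s)) ^ 2 / (M * (t - s))))) *
        psi1 m a a1 am y s ^ 2 ≤
      m * ∑ j, ∑ k, interaction M (a j) (a k) 1 x t (s, y) := by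
  have hτ : 0 < t - s := sub_pos.2 h1
  refine (mul_le_mul_of_nonneg_left (psi1_sq_le m a a1 am y h0) (by positivity)).trans
    (le_of_eq ?_)
  rw [mul_left_comm, mul_assoc, Finset.sum_mul_sum, Finset.mul_sum]
  congr 1
  refine Finset.sum_congr rfl fun j _ => ?_
  rw [Finset.mul_sum]
  refine Finset.sum_congr rfl fun k _ => ?_
  rw [interaction]
  ring

/-- Nonlinear interaction estimate for the inside-cone part `ψ₁²`. -/
theorem nonlinear_estimate_psi1 (m : ℕ) (hm : 2 ≤ m) (a : Fin m → ℝ) (ha : StrictMono a)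
    (ha1 : a ⟨0, by omega⟩ ≤ 0) (ham : 0 ≤ a ⟨m - 1, by omega⟩)
    (M : ℝ) (hM : 0 < M) :
    ∃ M' > M, ∃ C > 0, ∀ x t : ℝ, 0 < t →
      (∫ s in (0 : ℝ)..t, ∫ y : ℝ, (t - s)⁻¹ *
          (∑ j : Fin m, Real.exp (-((x - y - a j * (t - s)) ^ 2 / (M * (t - s))))) *
          (psi1 m a (a ⟨0, by omega⟩) (a ⟨m - 1, by omega⟩) y s) ^ 2)
        ≤ C * (theta m a M' x t +
            psi1 m a (a ⟨0, by omega⟩) (a ⟨m - 1, by omega⟩) x t +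
            psi2 (a ⟨0, by omega⟩) (a ⟨m - 1, by omega⟩) x t) := by
  set a1 := a ⟨0, by omega⟩ with ha1_eq
  set am := a ⟨m - 1, by omega⟩ with ham_eq
  have hle1 : ∀ j, a1 ≤ a j := fun j => ha.monotone (by simp [Fin.le_def])
  have hlem : ∀ j, a j ≤ am := fun j => ha.monotone (by simp only [Fin.le_def]; omega)
  set S := 48 * (4 + √(π * (2 * M)))
  have hS : 0 < S := by positivity
  set R := (1 + (am - a1)) ^ (1 / 2 : ℝ)
  have hw : 0 ≤ am - a1 := by linarith
  have hR : 1 ≤ R := one_le_rpow (by linarith) (by norm_num)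
  have hm0 : (0 : ℝ) < m := by exact_mod_cast (by omega : 0 < m)
  refine ⟨32 * M, by linarith, (m : ℝ) ^ 3 * (S * R), by positivity, fun x t ht => ?_⟩
  have : Nonempty (Fin m) := ⟨⟨0, by omega⟩⟩
  obtain ⟨i, hi⟩ := Finite.exists_min fun k => |x - a k * t|
  set μ := |x - a i * t|
  have hμ : 0 ≤ μ := abs_nonneg _
  set T := (1 + t) ^ (-(1 / 2 : ℝ))
  set e := exp (-(μ ^ 2 / (32 * M * t)))
  set L := (1 + μ) ^ (-(1 / 2 : ℝ))
  have hF0 : ∀ s ∈ Set.Ioo 0 t, ∀ y, 0 ≤ (t - s)⁻¹ *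
      (∑ j : Fin m, exp (-((x - y - a j * (t - s)) ^ 2 / (M * (t - s))))) *
        (psi1 m a a1 am y s) ^ 2 := by
    intro s hs y
    have : 0 < t - s := sub_pos.2 hs.2
    positivity
  have hθ : T * e ≤ theta m a (32 * M) x t := by
    have h := Finset.single_le_sum (f := fun j => T * exp (-((x - a j * t) ^ 2 / (32 * M * t))))
      (fun j _ => by positivity) (Finset.mem_univ i)
    simpa only [theta, e, μ, T, sq_abs] using h
  have hψ1 : 0 ≤ psi1 m a a1 am x t := psi1_nonneg m a a1 am x ht.le
  have hψ2 : 0 ≤ psi2 a1 am x t := by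
    unfold psi2 chi
    split_ifs
    · simp
    · have := sqrt_nonneg t
      positivity
  by_cases hx : a1 * t ≤ x ∧ x ≤ am * t
  · have hTL : T * L ≤ R * psi1 m a a1 am x t := by
      have h := Finset.single_le_sum
        (f := fun j => (1 + |x| + t) ^ (-(1 / 2 : ℝ)) * (1 + |x - a j * t|) ^ (-(1 / 2 : ℝ)))
        (fun j _ => by positivity) (Finset.mem_univ i)
      have hψ : (1 + |x| + t) ^ (-(1 / 2 : ℝ)) * L ≤ psi1 m a a1 am x t := by
        rw [psi1, chi, if_pos hx, one_mul]
        exact h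
      have habs : |x| ≤ (am - a1) * t := abs_le.2 ⟨by nlinarith [hx.1], by nlinarith [hx.2]⟩
      have hT : T ≤ R * (1 + |x| + t) ^ (-(1 / 2 : ℝ)) := by
        calc T = R * ((1 + (am - a1)) * (1 + t)) ^ (-(1 / 2 : ℝ)) := by
              rw [mul_rpow (by positivity) (by positivity), ← mul_assoc, ← rpow_add (by positivity)]
              norm_num
              rfl
          _ ≤ _ := by
              gcongr ?_ * ?_
              exact rpow_le_rpow_of_nonpos (by positivity) (by nlinarith) (by norm_num)
      calc T * L ≤ R * (1 + |x| + t) ^ (-(1 / 2 : ℝ)) * L := by gcongr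
        _ ≤ _ := by rw [mul_assoc]; gcongr
    refine (integral_integral_le_of_sum ht.le (K := S * (T * e + T * L)) (by positivity)
      (fun j k => measurable_interaction M (a j) (a k) 1 x t) hF0
      (fun s hs y j k => interaction_nonneg _ _ _ _ _ hs.1 hs.2)
      (fun s hs y => integrand_le_sum_interaction m a a1 am M x y hs.1 hs.2)
      (fun j k => lintegral_interaction_one_le hM ht hμ (hi j) (hi k))).trans ?_
    rw [mul_assoc ((m : ℝ) ^ 3), mul_assoc S]
    gcongr
    have : theta m a (32 * M) x t ≤ R * theta m a (32 * M) x t :=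
      le_mul_of_one_le_left (le_trans (by positivity) hθ) hR
    have : 0 ≤ R * psi2 a1 am x t := by positivity
    linarith
  · have hfar : ∀ s ∈ Set.Ioo 0 t, ∀ y, a1 * s ≤ y ∧ y ≤ am * s → ∀ j,
        μ ≤ 4 * |x - y - a j * (t - s)| := by
      intro s hs y hy j
      have hτ : 0 < t - s := sub_pos.2 hs.2
      have h1 := mul_le_mul_of_nonneg_right (hle1 j) hτ.le
      have h2 := mul_le_mul_of_nonneg_right (hlem j) hτ.le
      have h3 := abs_nonneg (x - y - a j * (t - s))
      rcases not_and_or.1 hx with h | h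
      · have h4 := hi ⟨0, by omega⟩
        rw [← ha1_eq, abs_of_neg (by linarith : x - a1 * t < 0)] at h4
        have h5 := neg_le_abs (x - y - a j * (t - s))
        linarith [hy.1]
      · have h4 := hi ⟨m - 1, by omega⟩
        rw [← ham_eq, abs_of_pos (by linarith : 0 < x - am * t)] at h4
        have h5 := le_abs_self (x - y - a j * (t - s))
        linarith [hy.2]
    refine (integral_integral_le_of_sum ht.le (K := S * (T * e)) (by positivity)
      (Φ := fun j k p => e * interaction (2 * M) (a j) (a k) (1 / 2) x t p)
      (fun j k => (measurable_interaction _ _ _ _ _ _).const_mul _) hF0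
      (fun s hs y j k => mul_nonneg (exp_pos _).le (interaction_nonneg _ _ _ _ _ hs.1 hs.2))
      (fun s hs y => ?_) (fun j k => ?_)).trans ?_
    · have hsum : 0 ≤ (m : ℝ) * ∑ j, ∑ k,
          e * interaction (2 * M) (a j) (a k) (1 / 2) x t (s, y) :=
        mul_nonneg hm0.le (Finset.sum_nonneg fun j _ => Finset.sum_nonneg fun k _ =>
          mul_nonneg (exp_pos _).le (interaction_nonneg _ _ _ _ _ hs.1 hs.2))
      by_cases hy : a1 * s ≤ y ∧ y ≤ am * s
      · refine (integrand_le_sum_interaction m a a1 am M x y hs.1 hs.2).trans ?_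
        gcongr with j _ k _
        exact interaction_one_le_of_far_kernel hM hμ hs.1 hs.2 (hfar s hs y hy j)
      · rw [psi1, chi, if_neg hy]
        simpa using hsum
    · refine (lintegral_le_of_far_kernel hM ht (a j) (a k) μ x).trans
        (ENNReal.ofReal_le_ofReal ?_)
      refine mul_le_mul_of_nonneg_right ?_ (by positivity)
      exact mul_le_mul_of_nonneg_right (by norm_num) (by positivity)
    · rw [mul_assoc ((m : ℝ) ^ 3), mul_assoc S]
      refine mul_le_mul_of_nonneg_left (mul_le_mul_of_nonneg_left ?_ hS.le) (by positivity)
      calc T * e ≤ 1 * (theta m a (32 * M) x t + psi1 m a a1 am x t + psi2 a1 am x t) := by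
            linarith
        _ ≤ _ := by 
          have : 0 ≤ T * e := by positivity
          gcongr
          linarith
end
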